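/- arXiv:1709.02423 — 4 statements merged into one kernel-verified Lean document; each statement's English description precedes it below -/
import Mathlib

section
/- Let the feasible semidefinite system (P_SD) satisfy the assumption that Z = diag(I_r, 0) is a maximum rank slack. Then (P_SD) is well behaved if and only if it has an elementary reformulation that is in good normal form. -/
open Matrix

/-- Trace inner product `S • T = trace(ST)` of square real matrices. -/
noncomputable def ip {k : ℕ} (S T : Matrix (Fin k) (Fin k) ℝ) : ℝ :=
  Matrix.trace (S * T)

/-- `x` is feasible for the semidefinite system `∑ xᵢ Aᵢ ⪯ B`. -/
def IsFeasible {n m : ℕ} (A : Fin m → Matrix (Fin n) (Fin n) ℝ)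
    (B : Matrix (Fin n) (Fin n) ℝ) (x : Fin m → ℝ) : Prop :=
  (B - ∑ i, x i • A i).PosSemidef

/-- The set of primal objective values `∑ cᵢ xᵢ` over feasible `x`. -/
def PrimalVals {n m : ℕ} (A : Fin m → Matrix (Fin n) (Fin n) ℝ)
    (B : Matrix (Fin n) (Fin n) ℝ) (c : Fin m → ℝ) : Set ℝ :=
  {s | ∃ x : Fin m → ℝ, IsFeasible A B x ∧ s = ∑ i, c i * x i}

/-- The system `∑ xᵢ Aᵢ ⪯ B` is badly behaved: for some `c` the primal optimal
value is finite (i.e. is a least upper bound `v`), but no dual feasible `Y`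
achieves value `v`. -/
def BadlyBehaved {n m : ℕ} (A : Fin m → Matrix (Fin n) (Fin n) ℝ)
    (B : Matrix (Fin n) (Fin n) ℝ) : Prop :=
  ∃ (c : Fin m → ℝ) (v : ℝ), IsLUB (PrimalVals A B c) v ∧
    ¬ ∃ Y : Matrix (Fin n) (Fin n) ℝ,
        Y.PosSemidef ∧ (∀ i, ip (A i) Y = c i) ∧ ip B Y = v

/-- `Zmat n r = diag(I_r, 0)`. -/
def Zmat (n r : ℕ) : Matrix (Fin n) (Fin n) ℝ :=
  Matrix.of fun i j => if i = j ∧ (i : ℕ) < r then (1 : ℝ) else 0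

/-- `Zmat n r` is a maximum rank slack of `∑ xᵢ Aᵢ ⪯ B`:
it is a slack and every slack has rank at most `r`. -/
def MaxRankSlack {n m : ℕ} (A : Fin m → Matrix (Fin n) (Fin n) ℝ)
    (B : Matrix (Fin n) (Fin n) ℝ) (r : ℕ) : Prop :=
  (∃ x : Fin m → ℝ, B - ∑ i, x i • A i = Zmat n r) ∧
  ∀ x : Fin m → ℝ, IsFeasible A B x → (B - ∑ i, x i • A i).rank ≤ r

/-- Lower-right `(n-r) × (n-r)` block. -/
def block22 {n : ℕ} (r : ℕ) (h : r ≤ n) (V : Matrix (Fin n) (Fin n) ℝ) :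
    Matrix (Fin (n - r)) (Fin (n - r)) ℝ :=
  Matrix.of fun i j => V ⟨r + i.1, by omega⟩ ⟨r + j.1, by omega⟩

/-- Upper-right `r × (n-r)` block. -/
def block12 {n : ℕ} (r : ℕ) (h : r ≤ n) (V : Matrix (Fin n) (Fin n) ℝ) :
    Matrix (Fin r) (Fin (n - r)) ℝ :=
  Matrix.of fun i j => V ⟨i.1, by omega⟩ ⟨r + j.1, by omega⟩

/-- The column space (range space) of a matrix. -/
def colSpace {p q : ℕ} (M : Matrix (Fin p) (Fin q) ℝ) : Submodule ℝ (Fin p → ℝ) :=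
  LinearMap.range M.mulVecLin

/-- The "Bad condition": some linear combination `V` of the `Aᵢ` has `V₂₂ ⪰ 0`
and `ℛ(V₁₂ᵀ) ⊄ ℛ(V₂₂)`. -/
def BadCond {n m : ℕ} (A : Fin m → Matrix (Fin n) (Fin n) ℝ) (r : ℕ) (h : r ≤ n) : Prop :=
  ∃ lam : Fin m → ℝ,
    (block22 r h (∑ i, lam i • A i)).PosSemidef ∧
    ¬ colSpace (block12 r h (∑ i, lam i • A i))ᵀ ≤
        colSpace (block22 r h (∑ i, lam i • A i))

/-- `padLow r h U = diag(0, U)` as an `n × n` matrix. -/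
def padLow {n : ℕ} (r : ℕ) (h : r ≤ n) (U : Matrix (Fin (n - r)) (Fin (n - r)) ℝ) :
    Matrix (Fin n) (Fin n) ℝ :=
  Matrix.of fun a b =>
    if hab : r ≤ (a : ℕ) ∧ r ≤ (b : ℕ) then U ⟨a.1 - r, by omega⟩ ⟨b.1 - r, by omega⟩
    else 0

/-- "Good condition 1": some positive definite `U` has `Aᵢ • diag(0, U) = 0` for all `i`. -/
def GoodCond1 {n m : ℕ} (A : Fin m → Matrix (Fin n) (Fin n) ℝ) (r : ℕ) (h : r ≤ n) : Prop :=
  ∃ U : Matrix (Fin (n - r)) (Fin (n - r)) ℝ, U.PosDef ∧ ∀ i, ip (A i) (padLow r h U) = 0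

/-- "Good condition 2": every linear combination of the `Aᵢ` with zero lower-right
block has zero upper-right block. -/
def GoodCond2 {n m : ℕ} (A : Fin m → Matrix (Fin n) (Fin n) ℝ) (r : ℕ) (h : r ≤ n) : Prop :=
  ∀ lam : Fin m → ℝ, block22 r h (∑ i, lam i • A i) = 0 →
    block12 r h (∑ i, lam i • A i) = 0

/-- `Tmat r h N = [[I_r, 0], [0, N]]`. -/
def Tmat {n : ℕ} (r : ℕ) (h : r ≤ n) (N : Matrix (Fin (n - r)) (Fin (n - r)) ℝ) :
    Matrix (Fin n) (Fin n) ℝ :=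
  Matrix.of fun a b =>
    if (a : ℕ) < r ∧ (b : ℕ) < r then (if a = b then (1 : ℝ) else 0)
    else if hab : r ≤ (a : ℕ) ∧ r ≤ (b : ℕ) then N ⟨a.1 - r, by omega⟩ ⟨b.1 - r, by omega⟩
    else 0

/-- The system `∑ xᵢ A'ᵢ ⪯ B'` is an elementary reformulation of `∑ xᵢ Aᵢ ⪯ B`:
there are an invertible `M : ℝ^{m×m}`, a vector `μ ∈ ℝ^m` and an invertible
`T = [[I_r, 0], [0, N]]` with `A'ᵢ = Tᵀ (∑ⱼ Mᵢⱼ Aⱼ) T` and `B' = Tᵀ (B + ∑ⱼ μⱼ Aⱼ) T`. -/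
def ElemReform {n m : ℕ} (r : ℕ) (h : r ≤ n)
    (A : Fin m → Matrix (Fin n) (Fin n) ℝ) (B : Matrix (Fin n) (Fin n) ℝ)
    (A' : Fin m → Matrix (Fin n) (Fin n) ℝ) (B' : Matrix (Fin n) (Fin n) ℝ) : Prop :=
  ∃ (M : Matrix (Fin m) (Fin m) ℝ) (μ : Fin m → ℝ)
    (N : Matrix (Fin (n - r)) (Fin (n - r)) ℝ),
    IsUnit M ∧ IsUnit (Tmat r h N) ∧
    (∀ i, A' i = (Tmat r h N)ᵀ * (∑ j, M i j • A j) * Tmat r h N) ∧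
    B' = (Tmat r h N)ᵀ * (B + ∑ j, μ j • A j) * Tmat r h N

/-- The last `n - r` columns of a square matrix, as an `n × (n-r)` matrix. -/
def lastCols {n : ℕ} (r : ℕ) (h : r ≤ n) (V : Matrix (Fin n) (Fin n) ℝ) :
    Matrix (Fin n) (Fin (n - r)) ℝ :=
  Matrix.of fun a j => V a ⟨r + j.1, by omega⟩

/-- Bad normal form of a semidefinite system. -/
def BadNormalForm {n m : ℕ} (A : Fin m → Matrix (Fin n) (Fin n) ℝ)
    (B : Matrix (Fin n) (Fin n) ℝ) (r : ℕ) (h : r ≤ n) : Prop :=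
  B = Zmat n r ∧ MaxRankSlack A B r ∧
  ∃ k : ℕ, ∃ hk : k < m,
    (∀ i : Fin m, (i : ℕ) < k → ∀ a b : Fin n, r ≤ (b : ℕ) → A i a b = 0) ∧
    (∀ i : Fin m, (i : ℕ) < k → ∀ a b : Fin n, r ≤ (a : ℕ) → A i a b = 0) ∧
    LinearIndependent ℝ (fun i : Fin (m - k) => lastCols r h (A ⟨k + i.1, by omega⟩)) ∧
    (block22 r h (A ⟨m - 1, by omega⟩)).PosSemidef

/-- Good normal form of a semidefinite system. -/
def GoodNormalForm {n m : ℕ} (A : Fin m → Matrix (Fin n) (Fin n) ℝ)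
    (B : Matrix (Fin n) (Fin n) ℝ) (r : ℕ) (h : r ≤ n) : Prop :=
  B = Zmat n r ∧ MaxRankSlack A B r ∧
  ∃ k : ℕ, ∃ _hk : k ≤ m,
    (∀ i : Fin m, (i : ℕ) < k → ∀ a b : Fin n,
        (r ≤ (a : ℕ) ∨ r ≤ (b : ℕ)) → A i a b = 0) ∧
    LinearIndependent ℝ (fun i : Fin (m - k) => block22 r h (A ⟨k + i.1, by omega⟩)) ∧
    ∃ U : Matrix (Fin (n - r)) (Fin (n - r)) ℝ, U.PosDef ∧
      ∀ i : Fin m, k ≤ (i : ℕ) → ip (block22 r h (A i)) U = 0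

/-- The image of the positive semidefinite cone under `Y ↦ (A₁ • Y, …, A_m • Y)`. -/
def imageSet {n m : ℕ} (A : Fin m → Matrix (Fin n) (Fin n) ℝ) : Set (Fin m → ℝ) :=
  {y | ∃ Y : Matrix (Fin n) (Fin n) ℝ, Y.PosSemidef ∧ ∀ i, ip (A i) Y = y i}

/-- A positive definite form dominates any other quadratic form up to a positive factor. -/
theorem exists_pos_quadForm_add_smul_nonneg {ι : Type*} [Fintype ι] (W U : Matrix ι ι ℝ)
    (hU : ∀ x : ι → ℝ, x ≠ 0 → 0 < x ⬝ᵥ U *ᵥ x) :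
    ∃ t : ℝ, 0 < t ∧ ∀ x : ι → ℝ, 0 ≤ x ⬝ᵥ (W + t • U) *ᵥ x := by
  have hcont : ∀ V : Matrix ι ι ℝ, Continuous fun x : ι → ℝ => x ⬝ᵥ V *ᵥ x := fun V => by
    fun_prop
  have hne : ∀ x ∈ Metric.sphere (0 : ι → ℝ) 1, x ≠ 0 := by
    rintro x hx rfl
    simp at hx
  obtain ⟨t, ht⟩ := ((isCompact_sphere (0 : ι → ℝ) 1).image_of_continuousOn
    (f := fun x => -(x ⬝ᵥ W *ᵥ x) / (x ⬝ᵥ U *ᵥ x))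
    ((hcont W).neg.continuousOn.div (hcont U).continuousOn
      fun x hx => (hU x (hne x hx)).ne')).bddAbove
  refine ⟨max t 1, by positivity, fun x => ?_⟩
  rcases eq_or_ne x 0 with rfl | hx
  · simp
  have hx' : ‖x‖ ≠ 0 := norm_ne_zero_iff.2 hx
  have hs : ‖x‖⁻¹ • x ∈ Metric.sphere (0 : ι → ℝ) 1 := by
    simp [norm_smul, hx']
  have h1 := ht (Set.mem_image_of_mem _ hs)
  have h2 := hU _ (hne _ hs)
  simp only [mulVec_smul, dotProduct_smul, smul_dotProduct, smul_eq_mul] at h1 h2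
  have h3 := hU x hx
  have h4 : -(‖x‖⁻¹ * (‖x‖⁻¹ * x ⬝ᵥ W *ᵥ x)) / (‖x‖⁻¹ * (‖x‖⁻¹ * x ⬝ᵥ U *ᵥ x))
      = -(x ⬝ᵥ W *ᵥ x) / (x ⬝ᵥ U *ᵥ x) := by
    field_simp
  rw [h4, div_le_iff₀ h3] at h1
  have h5 : t * x ⬝ᵥ U *ᵥ x ≤ max t 1 * x ⬝ᵥ U *ᵥ x :=
    mul_le_mul_of_nonneg_right (le_max_left _ _) h3.le
  simp only [add_mulVec, smul_mulVec, dotProduct_add, dotProduct_smul, smul_eq_mul]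
  linarith

/-- A linear functional on matrices is, on symmetric matrices, the trace pairing with a symmetric
matrix. -/
theorem exists_isSymm_forall_trace_mul_eq {ι : Type*} [Fintype ι]
    (g : Matrix ι ι ℝ →ₗ[ℝ] ℝ) :
    ∃ W : Matrix ι ι ℝ, W.IsSymm ∧ ∀ S : Matrix ι ι ℝ, S.IsSymm → g S = (S * W).trace := by
  classical
  have key : ∀ S : Matrix ι ι ℝ, g S = (S * (Matrix.of fun i j => g (single j i 1))).trace := by
    intro S
    conv_lhs => rw [matrix_eq_sum_single S]
    simp only [map_sum, trace, diag_apply, mul_apply, of_apply]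
    refine Finset.sum_congr rfl fun i _ => Finset.sum_congr rfl fun j _ => ?_
    rw [← smul_eq_mul, ← map_smul, smul_single, smul_eq_mul, mul_one]
  set W : Matrix ι ι ℝ := Matrix.of fun i j => g (single j i 1)
  refine ⟨(1 / 2 : ℝ) • (W + Wᵀ), ?_, fun S hS => ?_⟩
  · rw [IsSymm, transpose_smul, transpose_add, transpose_transpose, add_comm]
  · have h : (S * Wᵀ).trace = (S * W).trace := by
      rw [← trace_transpose, transpose_mul, transpose_transpose, hS.eq, trace_mul_comm]
    rw [key S, mul_smul_comm, trace_smul, mul_add, trace_add, h, smul_eq_mul]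
    ring

theorem trace_vecMulVec_mul {ι : Type*} [Fintype ι] (x : ι → ℝ) (W : Matrix ι ι ℝ) :
    (vecMulVec x x * W).trace = x ⬝ᵥ W *ᵥ x := by
  rw [trace_mul_comm, mul_vecMulVec, trace_vecMulVec, dotProduct_comm]

theorem isSymm_vecMulVec {ι : Type*} (x : ι → ℝ) : (vecMulVec x x).IsSymm := by
  rw [IsSymm, transpose_vecMulVec]

theorem Matrix.PosSemidef.of_isSymm {ι : Type*} [Fintype ι] {S : Matrix ι ι ℝ} (hS : S.IsSymm)
    (h : ∀ x : ι → ℝ, 0 ≤ x ⬝ᵥ S *ᵥ x) : S.PosSemidef :=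
  .of_dotProduct_mulVec_nonneg (by rwa [IsHermitian, conjTranspose_eq_transpose_of_trivial])
    (by simpa using h)

theorem Matrix.PosSemidef.isSymm {ι : Type*} {S : Matrix ι ι ℝ} (hS : S.PosSemidef) :
    S.IsSymm := by
  have := hS.isHermitian
  rwa [IsHermitian, conjTranspose_eq_transpose_of_trivial] at this

theorem Matrix.PosSemidef.quadForm_nonneg {ι : Type*} [Fintype ι] {S : Matrix ι ι ℝ}
    (hS : S.PosSemidef) (x : ι → ℝ) : 0 ≤ x ⬝ᵥ S *ᵥ x := by
  simpa using hS.dotProduct_mulVec_nonneg x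

/-- The product of two positive semidefinite matrices has nonnegative trace. -/
theorem Matrix.PosSemidef.trace_mul_nonneg {ι : Type*} [Fintype ι] {S U : Matrix ι ι ℝ}
    (hS : S.PosSemidef) (hU : U.PosSemidef) : 0 ≤ (S * U).trace := by
  classical
  obtain ⟨m, x, rfl⟩ := posSemidef_iff_eq_sum_vecMulVec.mp hS
  simp only [star_trivial, Finset.sum_mul, trace_sum, trace_vecMulVec_mul]
  exact Finset.sum_nonneg fun i _ => hU.quadForm_nonneg _

/-- A positive semidefinite matrix orthogonal to a positive definite one vanishes. -/
theorem Matrix.PosSemidef.eq_zero_of_trace_mul_eq_zero {ι : Type*} [Fintype ι]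
    {S U : Matrix ι ι ℝ} (hS : S.PosSemidef) (hU : U.PosDef) (h : (S * U).trace = 0) :
    S = 0 := by
  classical
  obtain ⟨m, x, rfl⟩ := posSemidef_iff_eq_sum_vecMulVec.mp hS
  simp only [star_trivial, Finset.sum_mul, trace_sum, trace_vecMulVec_mul] at h ⊢
  rw [Finset.sum_eq_zero_iff_of_nonneg fun i _ => hU.posSemidef.quadForm_nonneg _] at h
  refine Finset.sum_eq_zero fun i hi => ?_
  by_contra hne
  have hxi : x i ≠ 0 := by
    intro h0
    exact hne (by simp [h0])
  have := hU.dotProduct_mulVec_pos hxi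
  simp only [star_trivial] at this
  exact this.ne' (h i hi)

/-- The cone of real matrices with nonnegative quadratic form. -/
def quadNonnegCone (ι : Type*) [Fintype ι] : PointedCone ℝ (Matrix ι ι ℝ) where
  carrier := {S | ∀ x : ι → ℝ, 0 ≤ x ⬝ᵥ S *ᵥ x}
  add_mem' {S T} hS hT x := by
    rw [add_mulVec, dotProduct_add]
    exact add_nonneg (hS x) (hT x)
  zero_mem' x := by simp
  smul_mem' a S hS x := by
    have : a • S = (a : ℝ) • S := rfl
    rw [this, smul_mulVec, dotProduct_smul, smul_eq_mul]
    exact mul_nonneg a.2 (hS x)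

/-- Strong duality under the Slater condition: if zero is strictly feasible for `𝒜 x ⪯ 1`, then a
finite optimal value is attained by a dual solution. -/
theorem exists_dual_attaining_of_slater {V : Type*} [AddCommGroup V] [Module ℝ V] {ι : Type*}
    [Fintype ι] [DecidableEq ι] (𝒜 : V →ₗ[ℝ] Matrix ι ι ℝ) (hsymm : ∀ x, (𝒜 x).IsSymm)
    (c : V →ₗ[ℝ] ℝ) (v : ℝ) (hv : IsLUB {s | ∃ x, (1 - 𝒜 x).PosSemidef ∧ s = c x} v) :
    ∃ Y : Matrix ι ι ℝ, Y.PosSemidef ∧ (∀ x, (𝒜 x * Y).trace = c x) ∧ Y.trace = v := by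
  have psd : ∀ (s : ℝ) x, (∀ z : ι → ℝ, 0 ≤ z ⬝ᵥ (s • (1 : Matrix ι ι ℝ) - 𝒜 x) *ᵥ z) →
      (s • (1 : Matrix ι ι ℝ) - 𝒜 x).PosSemidef := fun s x h =>
    .of_isSymm (((isSymm_one).smul s).sub (hsymm x)) h
  have recession : ∀ x, (-𝒜 x).PosSemidef → c x ≤ 0 := by
    intro x hx
    by_contra! hc
    have h0 : 0 ≤ v := hv.1 ⟨0, by simpa using PosSemidef.one, by simp⟩
    have := hv.1 ⟨((v + 1) / c x) • x, ?_, rfl⟩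
    · rw [map_smul, smul_eq_mul, div_mul_cancel₀ _ hc.ne'] at this
      linarith
    · rw [map_smul, sub_eq_add_neg, ← smul_neg]
      exact PosSemidef.one.add (hx.smul (by positivity))
  have main : ∀ (s : ℝ) x, (s • (1 : Matrix ι ι ℝ) - 𝒜 x).PosSemidef → c x ≤ s * v := by
    intro s x h
    rcases lt_trichotomy s 0 with hs | rfl | hs
    · have : v ≤ c x / s := by
        refine hv.2 ?_
        rintro _ ⟨y, hy, rfl⟩
        have h1 := recession ((-s) • y + x) ?_
        · rw [map_add, map_smul, smul_eq_mul] at h1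
          rw [le_div_iff_of_neg hs]
          linarith
        · have := (hy.smul (a := -s) (by linarith)).add h
          convert this using 1
          rw [map_add, map_smul, smul_sub]
          module
      rw [le_div_iff_of_neg hs] at this
      linarith
    · simpa using recession x (by simpa using h)
    · have := hv.1 ⟨s⁻¹ • x, ?_, rfl⟩
      · rw [map_smul, smul_eq_mul, inv_mul_le_iff₀ hs] at this
        linarith
      · have := h.smul (a := s⁻¹) (by positivity)
        rwa [smul_sub, smul_smul, inv_mul_cancel₀ hs.ne', one_smul, ← map_smul] at this
  let Φ : ℝ × V →ₗ[ℝ] Matrix ι ι ℝ :=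
    (LinearMap.toSpanSingleton ℝ _ (1 : Matrix ι ι ℝ)).coprod (-𝒜)
  have hΦ : ∀ s x, Φ (s, x) = s • (1 : Matrix ι ι ℝ) - 𝒜 x := fun s x => by
    simp [Φ, sub_eq_add_neg]
  let F : ℝ × V →ₗ[ℝ] ℝ := (LinearMap.toSpanSingleton ℝ _ v).coprod (-c)
  have hF : ∀ s x, F (s, x) = s * v - c x := fun s x => by simp [F, sub_eq_add_neg]
  have hFΦ : F ∈ LinearMap.range Φ.dualMap := by
    rw [LinearMap.range_dualMap_eq_dualAnnihilator_ker, Submodule.mem_dualAnnihilator]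
    rintro ⟨s, x⟩ h
    rw [LinearMap.mem_ker, hΦ] at h
    have h1 := main s x (by rw [h]; exact .zero)
    have h2 := main (-s) (-x) (by
      rw [map_neg, neg_smul, sub_neg_eq_add, neg_add_eq_sub, ← neg_sub, h, neg_zero]
      exact .zero)
    rw [map_neg] at h2
    rw [hF]
    linarith
  obtain ⟨g₀, hg₀⟩ := hFΦ
  have hg₀' : ∀ p, g₀ (Φ p) = F p := fun p => LinearMap.congr_fun hg₀ p
  obtain ⟨g, hg, hgn⟩ := riesz_extension (quadNonnegCone ι)
    ⟨LinearMap.range Φ, g₀.domRestrict _⟩ (by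
      rintro ⟨_, ⟨⟨s, x⟩, rfl⟩⟩ h
      change 0 ≤ g₀ (Φ (s, x))
      rw [hg₀', hF]
      have := main s x (psd s x (by rw [← hΦ]; exact h))
      linarith) (by
      intro y
      obtain ⟨t, -, ht⟩ := exists_pos_quadForm_add_smul_nonneg y 1 (fun x hx => by
        simpa using PosDef.one.dotProduct_mulVec_pos hx)
      refine ⟨⟨Φ (t, 0), ⟨_, rfl⟩⟩, ?_⟩
      intro x
      have := ht x
      rwa [add_comm, ← sub_zero (t • (1 : Matrix ι ι ℝ)), ← map_zero 𝒜, ← hΦ] at this)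
  have hgΦ : ∀ s x, g (s • (1 : Matrix ι ι ℝ) - 𝒜 x) = s * v - c x := fun s x => by
    rw [← hF, ← hg₀', ← hΦ]
    exact hg ⟨Φ (s, x), ⟨_, rfl⟩⟩
  obtain ⟨Y, hYs, hY⟩ := exists_isSymm_forall_trace_mul_eq g
  refine ⟨Y, .of_isSymm hYs fun x => ?_, fun x => ?_, ?_⟩
  · rw [← trace_vecMulVec_mul, ← hY _ (isSymm_vecMulVec x)]
    refine hgn _ fun z => ?_
    simpa using (posSemidef_vecMulVec_self_star x).dotProduct_mulVec_nonneg z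
  · rw [← hY _ (hsymm x)]
    have := hgΦ 0 x
    rw [zero_smul, zero_sub, map_neg] at this
    linarith
  · have := hgΦ 1 0
    rw [one_smul, map_zero, sub_zero, hY _ isSymm_one, one_mul] at this
    simpa using this

/-- If a subspace of symmetric matrices meets the positive semidefinite cone only in zero, then
some positive definite matrix is orthogonal to it. -/
theorem exists_posDef_forall_trace_mul_eq_zero {ι : Type*} [Fintype ι]
    (L : Submodule ℝ (Matrix ι ι ℝ)) (hsymm : ∀ S ∈ L, S.IsSymm)
    (hL : ∀ S ∈ L, S.PosSemidef → S = 0) :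
    ∃ U : Matrix ι ι ℝ, U.PosDef ∧ ∀ S ∈ L, (S * U).trace = 0 := by
  have : LocallyConvexSpace ℝ (Matrix ι ι ℝ) :=
    inferInstanceAs (LocallyConvexSpace ℝ (ι → ι → ℝ))
  let Δ : Set (Matrix ι ι ℝ) := {S | S.PosSemidef ∧ S.trace = 1}
  have hΔconv : Convex ℝ Δ := by
    intro S hS T hT a b ha hb hab
    refine ⟨(hS.1.smul ha).add (hT.1.smul hb), ?_⟩
    simp [hS.2, hT.2, hab]
  have hentry : ∀ S : Matrix ι ι ℝ, S.PosSemidef → S.trace = 1 → ∀ i j, |S i j| ≤ 1 := by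
    classical
    intro S hS htr i j
    have hd : ∀ i, S i i ≤ 1 := fun i => by
      rw [← htr]
      exact Finset.single_le_sum (f := fun i => S i i) (fun k _ => hS.diag_nonneg)
        (Finset.mem_univ i)
    have h1 := hS.quadForm_nonneg (Pi.single i 1 + Pi.single j 1)
    have h2 := hS.quadForm_nonneg (Pi.single i 1 - Pi.single j 1)
    have h3 : S j i = S i j := hS.isSymm.apply i j
    simp [mulVec_add, mulVec_sub, h3] at h1 h2
    have := hd i
    have := hd j
    rw [abs_le]
    constructor <;> linarith
  have hΔclosed : IsClosed Δ := by
    have : Δ = {S | Sᵀ = S} ∩ (⋂ x : ι → ℝ, {S | 0 ≤ x ⬝ᵥ S *ᵥ x}) ∩ {S | S.trace = 1} := by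
      ext S
      simp only [Δ, Set.mem_ofPred_eq, Set.mem_inter_iff, Set.mem_iInter]
      exact ⟨fun h => ⟨⟨h.1.isSymm, h.1.quadForm_nonneg⟩, h.2⟩,
        fun h => ⟨.of_isSymm h.1.1 h.1.2, h.2⟩⟩
    rw [this]
    refine ((isClosed_eq (by fun_prop) continuous_id).inter (isClosed_iInter fun x => ?_)).inter
      (isClosed_eq (by fun_prop) continuous_const)
    exact isClosed_le continuous_const (by fun_prop)
  have hΔcompact : IsCompact Δ := by
    refine IsCompact.of_isClosed_subset (isCompact_univ_pi fun _ : ι => isCompact_univ_pi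
      fun _ : ι => isCompact_Icc (a := (-1 : ℝ)) (b := 1)) hΔclosed ?_
    intro S hS i _ j _
    exact abs_le.1 (hentry S hS.1 hS.2 i j)
  have hdisj : Disjoint Δ (L : Set (Matrix ι ι ℝ)) := by
    rw [Set.disjoint_left]
    rintro S ⟨hS, htr⟩ hSL
    rw [hL S hSL hS] at htr
    simp at htr
  have hLclosed : IsClosed (L : Set (Matrix ι ι ℝ)) := by
    exact L.closed_of_finiteDimensional
  obtain ⟨f, u, v, hu, huv, hv⟩ := geometric_hahn_banach_compact_closed hΔconv hΔcompact
    L.convex hLclosed hdisj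
  have hv0 : v < 0 := by simpa using hv 0 L.zero_mem
  have hf0 : ∀ S ∈ L, f S = 0 := by
    intro S hS
    by_contra hne
    have := hv _ (L.smul_mem (v / f S) hS)
    rw [map_smul, smul_eq_mul, div_mul_cancel₀ _ hne] at this
    exact lt_irrefl _ this
  obtain ⟨W, hWs, hW⟩ := exists_isSymm_forall_trace_mul_eq (-f.toLinearMap)
  refine ⟨W, .of_dotProduct_mulVec_pos
    (by rwa [IsHermitian, conjTranspose_eq_transpose_of_trivial]) fun x hx => ?_, fun S hS => ?_⟩
  · rw [star_trivial, ← trace_vecMulVec_mul, ← hW _ (isSymm_vecMulVec x)]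
    have hpos : 0 < x ⬝ᵥ x := by
      simpa using (dotProduct_star_self_pos_iff (v := x)).2 hx
    have h1 := hu ((x ⬝ᵥ x)⁻¹ • vecMulVec x x) ⟨?_, ?_⟩
    · rw [map_smul, smul_eq_mul, inv_mul_lt_iff₀ hpos] at h1
      have : x ⬝ᵥ x * u < 0 := mul_neg_of_pos_of_neg hpos (huv.trans hv0)
      change 0 < -f (vecMulVec x x)
      linarith
    · exact (posSemidef_vecMulVec_self_star x).smul (by positivity)
    · rw [trace_smul, trace_vecMulVec, smul_eq_mul, inv_mul_cancel₀ hpos.ne']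
  · rw [← hW _ (hsymm S hS)]
    change -f S = 0
    rw [hf0 S hS, neg_zero]

/-- Index equivalence splitting off the first `r` coordinates. -/
def splitEquiv {n : ℕ} (r : ℕ) (h : r ≤ n) : Fin r ⊕ Fin (n - r) ≃ Fin n :=
  finSumFinEquiv.trans (finCongr (by omega))

theorem splitEquiv_inl_val {n r : ℕ} (h : r ≤ n) (i : Fin r) :
    (splitEquiv r h (Sum.inl i) : ℕ) = i := by
  simp [splitEquiv]

theorem splitEquiv_inr_val {n r : ℕ} (h : r ≤ n) (j : Fin (n - r)) :
    (splitEquiv r h (Sum.inr j) : ℕ) = r + j := by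
  simp [splitEquiv]

/-- Upper-left `r × r` block. -/
def block11 {n : ℕ} (r : ℕ) (h : r ≤ n) (V : Matrix (Fin n) (Fin n) ℝ) :
    Matrix (Fin r) (Fin r) ℝ :=
  V.submatrix (fun i => ⟨i.1, by omega⟩) (fun i => ⟨i.1, by omega⟩)

/-- Lower-left `(n-r) × r` block. -/
def block21 {n : ℕ} (r : ℕ) (h : r ≤ n) (V : Matrix (Fin n) (Fin n) ℝ) :
    Matrix (Fin (n - r)) (Fin r) ℝ :=
  V.submatrix (fun i => ⟨r + i.1, by omega⟩) (fun i => ⟨i.1, by omega⟩)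

/-- The matrix with the given four blocks. -/
def ofBlocks {n : ℕ} (r : ℕ) (h : r ≤ n) (S₁₁ : Matrix (Fin r) (Fin r) ℝ)
    (S₁₂ : Matrix (Fin r) (Fin (n - r)) ℝ) (S₂₁ : Matrix (Fin (n - r)) (Fin r) ℝ)
    (S₂₂ : Matrix (Fin (n - r)) (Fin (n - r)) ℝ) : Matrix (Fin n) (Fin n) ℝ :=
  (fromBlocks S₁₁ S₁₂ S₂₁ S₂₂).submatrix (splitEquiv r h).symm (splitEquiv r h).symm

theorem submatrix_splitEquiv {n r : ℕ} (h : r ≤ n) (V : Matrix (Fin n) (Fin n) ℝ) :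
    V.submatrix (splitEquiv r h) (splitEquiv r h) =
      fromBlocks (block11 r h V) (block12 r h V) (block21 r h V) (block22 r h V) := by
  ext i j
  rcases i with i | i <;> rcases j with j | j <;>
    simp only [submatrix_apply, fromBlocks_apply₁₁, fromBlocks_apply₁₂, fromBlocks_apply₂₁,
      fromBlocks_apply₂₂, block11, block12, block21, block22, of_apply] <;>
    congr 1

theorem submatrix_ofBlocks {n r : ℕ} (h : r ≤ n) (S₁₁ : Matrix (Fin r) (Fin r) ℝ)
    (S₁₂ : Matrix (Fin r) (Fin (n - r)) ℝ) (S₂₁ : Matrix (Fin (n - r)) (Fin r) ℝ)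
    (S₂₂ : Matrix (Fin (n - r)) (Fin (n - r)) ℝ) :
    (ofBlocks r h S₁₁ S₁₂ S₂₁ S₂₂).submatrix (splitEquiv r h) (splitEquiv r h) =
      fromBlocks S₁₁ S₁₂ S₂₁ S₂₂ := by
  simp [ofBlocks]

theorem ofBlocks_block {n r : ℕ} (h : r ≤ n) (V : Matrix (Fin n) (Fin n) ℝ) :
    ofBlocks r h (block11 r h V) (block12 r h V) (block21 r h V) (block22 r h V) = V := by
  rw [ofBlocks, ← submatrix_splitEquiv]
  simp

theorem blocks_ofBlocks {n r : ℕ} (h : r ≤ n) (S₁₁ : Matrix (Fin r) (Fin r) ℝ)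
    (S₁₂ : Matrix (Fin r) (Fin (n - r)) ℝ) (S₂₁ : Matrix (Fin (n - r)) (Fin r) ℝ)
    (S₂₂ : Matrix (Fin (n - r)) (Fin (n - r)) ℝ) :
    block11 r h (ofBlocks r h S₁₁ S₁₂ S₂₁ S₂₂) = S₁₁ ∧
    block12 r h (ofBlocks r h S₁₁ S₁₂ S₂₁ S₂₂) = S₁₂ ∧
    block21 r h (ofBlocks r h S₁₁ S₁₂ S₂₁ S₂₂) = S₂₁ ∧
    block22 r h (ofBlocks r h S₁₁ S₁₂ S₂₁ S₂₂) = S₂₂ := by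
  rw [← fromBlocks_inj, ← submatrix_splitEquiv, submatrix_ofBlocks]

theorem ip_eq_trace_submatrix {n r : ℕ} (h : r ≤ n) (S T : Matrix (Fin n) (Fin n) ℝ) :
    ip S T = (S.submatrix (splitEquiv r h) (splitEquiv r h) *
      T.submatrix (splitEquiv r h) (splitEquiv r h)).trace := by
  rw [submatrix_mul_equiv, ip]
  exact ((splitEquiv r h).sum_comp fun i => (S * T) i i).symm

theorem ip_ofBlocks {n r : ℕ} (h : r ≤ n) (S : Matrix (Fin n) (Fin n) ℝ)
    (T₁₁ : Matrix (Fin r) (Fin r) ℝ)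
    (T₁₂ : Matrix (Fin r) (Fin (n - r)) ℝ) (T₂₁ : Matrix (Fin (n - r)) (Fin r) ℝ)
    (T₂₂ : Matrix (Fin (n - r)) (Fin (n - r)) ℝ) :
    ip S (ofBlocks r h T₁₁ T₁₂ T₂₁ T₂₂) =
      ((block11 r h S * T₁₁).trace + (block12 r h S * T₂₁).trace) +
      ((block21 r h S * T₁₂).trace + (block22 r h S * T₂₂).trace) := by
  rw [ip_eq_trace_submatrix h, submatrix_ofBlocks, submatrix_splitEquiv, fromBlocks_multiply,
    ← trace_add, ← trace_add]
  simp [trace, Fintype.sum_sum_type]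

theorem posSemidef_ofBlocks_diagonal {n r : ℕ} (h : r ≤ n) {S₁₁ : Matrix (Fin r) (Fin r) ℝ}
    {S₂₂ : Matrix (Fin (n - r)) (Fin (n - r)) ℝ} (h₁ : S₁₁.PosSemidef) (h₂ : S₂₂.PosSemidef) :
    (ofBlocks r h S₁₁ 0 0 S₂₂).PosSemidef := by
  refine PosSemidef.submatrix (.of_isSymm ?_ fun x => ?_) _
  · exact h₁.isSymm.fromBlocks transpose_zero h₂.isSymm
  · rw [← Sum.elim_comp_inl_inr x, fromBlocks_mulVec, _root_.sumElim_dotProduct_sumElim]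
    simpa using add_nonneg (h₁.quadForm_nonneg _) (h₂.quadForm_nonneg _)

theorem block21_of_isSymm {n r : ℕ} (h : r ≤ n) {V : Matrix (Fin n) (Fin n) ℝ}
    (hV : V.IsSymm) : block21 r h V = (block12 r h V)ᵀ := by
  ext i j
  exact hV.apply _ _

theorem isSymm_block11 {n r : ℕ} (h : r ≤ n) {V : Matrix (Fin n) (Fin n) ℝ}
    (hV : V.IsSymm) : (block11 r h V).IsSymm :=
  hV.submatrix _

theorem isSymm_block22 {n r : ℕ} (h : r ≤ n) {V : Matrix (Fin n) (Fin n) ℝ}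
    (hV : V.IsSymm) : (block22 r h V).IsSymm :=
  hV.submatrix _

theorem Zmat_eq_ofBlocks {n r : ℕ} (h : r ≤ n) : Zmat n r = ofBlocks r h 1 0 0 0 := by
  have : (Zmat n r).submatrix (splitEquiv r h) (splitEquiv r h) = fromBlocks 1 0 0 0 := by
    ext i j
    rcases i with i | i <;> rcases j with j | j <;>
      simp [Zmat, splitEquiv_inl_val, splitEquiv_inr_val, one_apply]
  rw [ofBlocks, ← this]
  simp

theorem posSemidef_Zmat {n r : ℕ} (h : r ≤ n) : (Zmat n r).PosSemidef := by
  rw [Zmat_eq_ofBlocks h]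
  exact posSemidef_ofBlocks_diagonal h .one .zero

theorem Zmat_eq_diagonal (n r : ℕ) :
    Zmat n r = diagonal fun i : Fin n => if (i : ℕ) < r then (1 : ℝ) else 0 := by
  ext i j
  by_cases hij : i = j <;> simp [Zmat, hij]

theorem rank_Zmat {n r : ℕ} (h : r ≤ n) : (Zmat n r).rank = r := by
  rw [Zmat_eq_diagonal, rank_diagonal, Fintype.card_subtype]
  simpa [h] using Fin.card_filter_val_lt (n := n) (m := r)

/-- If averaging a positive semidefinite matrix with `diag(I_r, 0)` does not increase the rank,
then its last columns vanish. -/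
theorem apply_eq_zero_of_rank_half_add_Zmat_le {n r : ℕ} (h : r ≤ n) {S : Matrix (Fin n) (Fin n) ℝ}
    (hS : S.PosSemidef) (hrank : ((1 / 2 : ℝ) • (S + Zmat n r)).rank ≤ r) (a b : Fin n)
    (hb : r ≤ (b : ℕ)) : S a b = 0 := by
  set P := (1 / 2 : ℝ) • (S + Zmat n r)
  have hle : LinearMap.ker P.mulVecLin ≤ LinearMap.ker (Zmat n r).mulVecLin := by
    intro x hx
    rw [LinearMap.mem_ker, mulVecLin_apply] at hx ⊢
    have h0 : x ⬝ᵥ P *ᵥ x = 0 := by rw [hx, dotProduct_zero]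
    simp only [P, smul_mulVec, add_mulVec, dotProduct_smul, dotProduct_add, smul_eq_mul] at h0
    have h1 := hS.quadForm_nonneg x
    have h2 := (posSemidef_Zmat h).quadForm_nonneg x
    refine ((posSemidef_Zmat h).dotProduct_mulVec_zero_iff x).1 ?_
    rw [star_trivial]
    linarith
  have heq : LinearMap.ker P.mulVecLin = LinearMap.ker (Zmat n r).mulVecLin := by
    refine Submodule.eq_of_le_of_finrank_le hle ?_
    have h1 := P.mulVecLin.finrank_range_add_finrank_ker
    have h2 := (Zmat n r).mulVecLin.finrank_range_add_finrank_ker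
    have h3 : Module.finrank ℝ (LinearMap.range P.mulVecLin) ≤ r := hrank
    have h4 : Module.finrank ℝ (LinearMap.range (Zmat n r).mulVecLin) = r := rank_Zmat h
    omega
  have hZb : (Zmat n r) *ᵥ Pi.single b 1 = 0 := by
    ext i
    simp [Zmat]
    intro hi
    subst hi
    exact hb
  have hb' : Pi.single b 1 ∈ LinearMap.ker P.mulVecLin := by
    rw [heq, LinearMap.mem_ker, mulVecLin_apply, hZb]
  rw [LinearMap.mem_ker, mulVecLin_apply] at hb'
  simp only [P, smul_mulVec, add_mulVec, hZb, add_zero] at hb'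
  have := congrFun hb' a
  simpa using this

theorem block_add {n r : ℕ} (h : r ≤ n) (V W : Matrix (Fin n) (Fin n) ℝ) :
    block11 r h (V + W) = block11 r h V + block11 r h W ∧
    block12 r h (V + W) = block12 r h V + block12 r h W ∧
    block22 r h (V + W) = block22 r h V + block22 r h W :=
  ⟨rfl, rfl, rfl⟩

theorem block_smul {n r : ℕ} (h : r ≤ n) (t : ℝ) (V : Matrix (Fin n) (Fin n) ℝ) :
    block11 r h (t • V) = t • block11 r h V ∧
    block12 r h (t • V) = t • block12 r h V ∧
    block22 r h (t • V) = t • block22 r h V :=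
  ⟨rfl, rfl, rfl⟩

theorem block_sum_smul {n m r : ℕ} (h : r ≤ n) (x : Fin m → ℝ)
    (A : Fin m → Matrix (Fin n) (Fin n) ℝ) :
    block11 r h (∑ i, x i • A i) = ∑ i, x i • block11 r h (A i) ∧
    block12 r h (∑ i, x i • A i) = ∑ i, x i • block12 r h (A i) ∧
    block22 r h (∑ i, x i • A i) = ∑ i, x i • block22 r h (A i) := by
  refine ⟨?_, ?_, ?_⟩ <;> ext a b <;>
    simp [block11, block12, block22, Matrix.sum_apply]

theorem block_Zmat {n r : ℕ} (h : r ≤ n) :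
    block11 r h (Zmat n r) = 1 ∧ block12 r h (Zmat n r) = 0 ∧ block22 r h (Zmat n r) = 0 := by
  rw [Zmat_eq_ofBlocks h]
  exact ⟨(blocks_ofBlocks h _ _ _ _).1, (blocks_ofBlocks h _ _ _ _).2.1,
    (blocks_ofBlocks h _ _ _ _).2.2.2⟩

theorem posSemidef_of_block12_eq_zero {n r : ℕ} (h : r ≤ n) {S : Matrix (Fin n) (Fin n) ℝ}
    (hS : S.IsSymm) (h₁₁ : (block11 r h S).PosSemidef) (h₁₂ : block12 r h S = 0)
    (h₂₂ : (block22 r h S).PosSemidef) : S.PosSemidef := by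
  rw [← ofBlocks_block h S, block21_of_isSymm h hS, h₁₂, transpose_zero]
  exact posSemidef_ofBlocks_diagonal h h₁₁ h₂₂

theorem ip_add {k : ℕ} (S T Y : Matrix (Fin k) (Fin k) ℝ) :
    ip (S + T) Y = ip S Y + ip T Y := by
  simp [ip, add_mul]

theorem ip_sum_smul {k m : ℕ} (x : Fin m → ℝ) (A : Fin m → Matrix (Fin k) (Fin k) ℝ)
    (Y : Matrix (Fin k) (Fin k) ℝ) : ip (∑ i, x i • A i) Y = ∑ i, x i * ip (A i) Y := by
  simp [ip, Finset.sum_mul, trace_sum]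

theorem isSymm_sum_smul {k m : ℕ} (x : Fin m → ℝ) {A : Fin m → Matrix (Fin k) (Fin k) ℝ}
    (hA : ∀ i, (A i).IsSymm) : (∑ i, x i • A i).IsSymm := by
  rw [IsSymm, transpose_sum]
  exact Finset.sum_congr rfl fun i _ => ((hA i).smul (x i)).eq

theorem slack_apply_eq_zero {n m r : ℕ} (h : r ≤ n) {A : Fin m → Matrix (Fin n) (Fin n) ℝ}
    {B : Matrix (Fin n) (Fin n) ℝ} (hZ : MaxRankSlack A B r) {x : Fin m → ℝ}
    (hx : IsFeasible A B x) (a b : Fin n) (hb : r ≤ (b : ℕ)) :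
    (B - ∑ i, x i • A i) a b = 0 := by
  obtain ⟨⟨x₀, hx₀⟩, hmax⟩ := hZ
  refine apply_eq_zero_of_rank_half_add_Zmat_le h hx ?_ a b hb
  have heq : (1 / 2 : ℝ) • ((B - ∑ i, x i • A i) + Zmat n r) =
      B - ∑ i, ((1 / 2 : ℝ) • (x + x₀)) i • A i := by
    simp only [← hx₀, Pi.smul_apply, Pi.add_apply, smul_assoc, add_smul, ← Finset.smul_sum,
      Finset.sum_add_distrib]
    module
  have hfeas : IsFeasible A B ((1 / 2 : ℝ) • (x + x₀)) := by
    rw [IsFeasible, ← heq]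
    exact (hx.add (posSemidef_Zmat h)).smul (by norm_num)
  rw [heq]
  exact hmax _ hfeas

theorem slack_block_eq_zero {n m r : ℕ} (h : r ≤ n) {A : Fin m → Matrix (Fin n) (Fin n) ℝ}
    {B : Matrix (Fin n) (Fin n) ℝ} (hZ : MaxRankSlack A B r) {x : Fin m → ℝ}
    (hx : IsFeasible A B x) :
    block12 r h (B - ∑ i, x i • A i) = 0 ∧ block22 r h (B - ∑ i, x i • A i) = 0 := by
  constructor <;> ext a b <;> exact slack_apply_eq_zero h hZ hx _ _ (Nat.le_add_right _ _)

/-- In a well behaved system, a combination with positive semidefinite lower-right block has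
vanishing upper-right block. -/
theorem block12_eq_zero_of_not_badlyBehaved {n m r : ℕ} (h : r ≤ n)
    {A : Fin m → Matrix (Fin n) (Fin n) ℝ} {B : Matrix (Fin n) (Fin n) ℝ}
    (hA : ∀ i, (A i).IsSymm) (hB : B.IsSymm) (hZ : MaxRankSlack A B r)
    (hgood : ¬ BadlyBehaved A B) (lam : Fin m → ℝ)
    (hlam : (block22 r h (∑ i, lam i • A i)).PosSemidef) :
    block12 r h (∑ i, lam i • A i) = 0 := by
  set V := ∑ i, lam i • A i with hV
  set Y₀ := ofBlocks r h 0 (-block12 r h V) (-(block12 r h V)ᵀ) 0 with hY₀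
  have hVs : V.IsSymm := isSymm_sum_smul lam hA
  have hslack : ∀ x, IsFeasible A B x → ip (B - ∑ i, x i • A i) Y₀ = 0 := by
    intro x hx
    rw [hY₀, ip_ofBlocks, block21_of_isSymm h (hB.sub (isSymm_sum_smul x hA)),
      (slack_block_eq_zero h hZ hx).1]
    simp
  have hsub : ∀ (x : Fin m → ℝ) Y, ip B Y = ip (B - ∑ i, x i • A i) Y + ∑ i, x i * ip (A i) Y :=
    fun x Y => by rw [← ip_sum_smul, ← ip_add, sub_add_cancel]
  obtain ⟨x₀, hx₀⟩ := hZ.1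
  have hx₀f : IsFeasible A B x₀ := by
    rw [IsFeasible, hx₀]
    exact posSemidef_Zmat h
  have hprimal : PrimalVals A B (fun i => ip (A i) Y₀) = {ip B Y₀} := by
    have hval : ∀ x, IsFeasible A B x → ∑ i, ip (A i) Y₀ * x i = ip B Y₀ := by
      intro x hx
      rw [hsub x, hslack x hx, zero_add]
      simp only [mul_comm]
    ext s
    simp only [PrimalVals, Set.mem_ofPred_eq, Set.mem_singleton_iff]
    exact ⟨fun ⟨x, hx, hs⟩ => hs.trans (hval x hx), fun hs => ⟨x₀, hx₀f, hs.trans (hval x₀ hx₀f).symm⟩⟩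
  by_contra hne
  refine hgood ⟨fun i => ip (A i) Y₀, ip B Y₀, ?_, ?_⟩
  · rw [hprimal]
    exact isLUB_singleton
  rintro ⟨Y, hYpsd, hYA, hYB⟩
  have hZY : ip (Zmat n r) Y = 0 := by
    have h1 := hsub x₀ Y
    have h2 := hsub x₀ Y₀
    have h3 := hslack x₀ hx₀f
    rw [hx₀] at h1 h2 h3
    simp only [hYA, hYB] at h1
    linarith
  have hYsymm := hYpsd.isSymm
  have h11 : block11 r h Y = 0 := by
    refine PosSemidef.eq_zero_of_trace_mul_eq_zero (hYpsd.submatrix _) PosDef.one ?_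
    rw [← ofBlocks_block h Y, ip_ofBlocks, (block_Zmat h).1, (block_Zmat h).2.1,
      (block_Zmat h).2.2, block21_of_isSymm h (posSemidef_Zmat h).isSymm, (block_Zmat h).2.1] at hZY
    simpa using hZY
  have h21 : block21 r h Y = 0 := by
    ext a b
    have hbb : Y ⟨b.1, by omega⟩ ⟨b.1, by omega⟩ = 0 := congrFun (congrFun h11 b) b
    have := (hYpsd.dotProduct_mulVec_zero_iff (Pi.single ⟨b.1, by omega⟩ 1)).1 (by simpa using hbb)
    have h1 := congrFun this ⟨r + a.1, by omega⟩
    rwa [mulVec_single_one] at h1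
  have h12 : block12 r h Y = 0 := by
    rw [block21_of_isSymm h hYsymm] at h21
    simpa using h21
  have hVY : 0 ≤ ip V Y := by
    rw [← ofBlocks_block h Y, ip_ofBlocks, h11, h21, h12]
    have h22 : (block22 r h Y).PosSemidef := hYpsd.submatrix _
    simpa using hlam.trace_mul_nonneg h22
  have hVY₀ : ip V Y = ip V Y₀ := by
    rw [hV, ip_sum_smul, ip_sum_smul]
    simp only [hYA]
  have htr : (block12 r h V * (block12 r h V)ᵀ).trace = 0 := by
    rw [hVY₀, hY₀, ip_ofBlocks, block21_of_isSymm h hVs] at hVY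
    have h1 : ((block12 r h V)ᵀ * block12 r h V).trace =
      (block12 r h V * (block12 r h V)ᵀ).trace := trace_mul_comm _ _
    have h2 : 0 ≤ (block12 r h V * (block12 r h V)ᵀ).trace := by
      simpa [conjTranspose_eq_transpose_of_trivial] using
        (posSemidef_self_mul_conjTranspose (block12 r h V)).trace_nonneg
    simp only [Matrix.mul_neg, Matrix.mul_zero, trace_neg, trace_zero, h1] at hVY
    linarith
  rw [← conjTranspose_eq_transpose_of_trivial, trace_mul_conjTranspose_self_eq_zero_iff] at htr
  exact hne htr

/-- If a combination has zero upper-right block and positive semidefinite lower-right block, then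
the latter vanishes, since otherwise a slack of rank larger than `r` would exist. -/
theorem block22_eq_zero_of_maxRankSlack {n m r : ℕ} (h : r ≤ n)
    {A : Fin m → Matrix (Fin n) (Fin n) ℝ} {B : Matrix (Fin n) (Fin n) ℝ}
    (hA : ∀ i, (A i).IsSymm) (hZ : MaxRankSlack A B r) (lam : Fin m → ℝ)
    (hlam : (block22 r h (∑ i, lam i • A i)).PosSemidef)
    (h12 : block12 r h (∑ i, lam i • A i) = 0) :
    block22 r h (∑ i, lam i • A i) = 0 := by
  set V := ∑ i, lam i • A i with hV
  have hVs : V.IsSymm := isSymm_sum_smul lam hA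
  obtain ⟨x₀, hx₀⟩ := hZ.1
  obtain ⟨t, ht, hpos⟩ := exists_pos_quadForm_add_smul_nonneg (block11 r h V) 1 (fun x hx => by
    simpa using PosDef.one.dotProduct_mulVec_pos hx)
  have hslack : B - ∑ i, (x₀ - t⁻¹ • lam) i • A i = Zmat n r + t⁻¹ • V := by
    simp only [← hx₀, hV, Pi.sub_apply, Pi.smul_apply, sub_smul, Finset.sum_sub_distrib,
      smul_assoc, ← Finset.smul_sum]
    abel
  have hfeas : IsFeasible A B (x₀ - t⁻¹ • lam) := by
    rw [IsFeasible, hslack]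
    refine posSemidef_of_block12_eq_zero h ((posSemidef_Zmat h).isSymm.add (hVs.smul _)) ?_ ?_ ?_
    · rw [(block_add h _ _).1, (block_smul h _ _).1, (block_Zmat h).1]
      have : 1 + t⁻¹ • block11 r h V = t⁻¹ • (block11 r h V + t • 1) := by
        rw [smul_add, smul_smul, inv_mul_cancel₀ ht.ne', one_smul, add_comm]
      rw [this]
      exact (PosSemidef.of_isSymm ((isSymm_block11 h hVs).add (isSymm_one.smul t)) hpos).smul
        (by positivity)
    · rw [(block_add h _ _).2.1, (block_smul h _ _).2.1, (block_Zmat h).2.1, h12, smul_zero,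
        add_zero]
    · rw [(block_add h _ _).2.2, (block_smul h _ _).2.2, (block_Zmat h).2.2, zero_add]
      exact hlam.smul (by positivity)
  have := (slack_block_eq_zero h hZ hfeas).2
  rw [hslack, (block_add h _ _).2.2, (block_smul h _ _).2.2, (block_Zmat h).2.2, zero_add] at this
  exact (smul_eq_zero.1 this).resolve_left (by positivity)

theorem goodConds_of_not_badlyBehaved {n m r : ℕ} (h : r ≤ n)
    {A : Fin m → Matrix (Fin n) (Fin n) ℝ} {B : Matrix (Fin n) (Fin n) ℝ}
    (hA : ∀ i, (A i).IsSymm) (hB : B.IsSymm) (hZ : MaxRankSlack A B r)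
    (hgood : ¬ BadlyBehaved A B) :
    (∃ U : Matrix (Fin (n - r)) (Fin (n - r)) ℝ, U.PosDef ∧
      ∀ i, (block22 r h (A i) * U).trace = 0) ∧ GoodCond2 A r h := by
  refine ⟨?_, fun lam hlam => block12_eq_zero_of_not_badlyBehaved h hA hB hZ hgood lam
    (by rw [hlam]; exact .zero)⟩
  obtain ⟨U, hU, hUL⟩ := exists_posDef_forall_trace_mul_eq_zero
    (LinearMap.range (Fintype.linearCombination ℝ fun i => block22 r h (A i))) (by
      rintro _ ⟨lam, rfl⟩
      rw [Fintype.linearCombination_apply]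
      exact isSymm_sum_smul lam fun i => isSymm_block22 h (hA i)) (by
      rintro _ ⟨lam, rfl⟩ hpsd
      rw [Fintype.linearCombination_apply, ← (block_sum_smul h lam A).2.2] at hpsd ⊢
      exact block22_eq_zero_of_maxRankSlack h hA hZ lam hpsd
        (block12_eq_zero_of_not_badlyBehaved h hA hB hZ hgood lam hpsd))
  refine ⟨U, hU, fun i => hUL _ ⟨Pi.single i 1, ?_⟩⟩
  simp

/-- Under the two good conditions, the feasible set is described by its upper-left block, for which
the Slater condition holds, and the resulting dual solution extends to the whole system. -/
theorem not_badlyBehaved_of_goodConds {n m r : ℕ} (h : r ≤ n)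
    {A : Fin m → Matrix (Fin n) (Fin n) ℝ} {B : Matrix (Fin n) (Fin n) ℝ}
    (hA : ∀ i, (A i).IsSymm) (hZ : MaxRankSlack A B r)
    {U : Matrix (Fin (n - r)) (Fin (n - r)) ℝ} (hU : U.PosDef)
    (hAU : ∀ i, (block22 r h (A i) * U).trace = 0) (hG : GoodCond2 A r h) :
    ¬ BadlyBehaved A B := by
  rintro ⟨c, v, hv, hno⟩
  obtain ⟨x₀, hx₀⟩ := hZ.1
  let Φ₁ := Fintype.linearCombination ℝ fun i => block11 r h (A i)
  let Φ₂ := Fintype.linearCombination ℝ fun i => block22 r h (A i)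
  let γ : (Fin m → ℝ) →ₗ[ℝ] ℝ := Fintype.linearCombination ℝ c
  have hΦ₁ : ∀ x, Φ₁ x = block11 r h (∑ i, x i • A i) := fun x => by
    rw [(block_sum_smul h x A).1, Fintype.linearCombination_apply]
  have hΦ₂ : ∀ x, Φ₂ x = block22 r h (∑ i, x i • A i) := fun x => by
    rw [(block_sum_smul h x A).2.2, Fintype.linearCombination_apply]
  have hγ : ∀ x, γ x = ∑ i, c i * x i := fun x => by
    simp only [γ, Fintype.linearCombination_apply, smul_eq_mul, mul_comm]
  have hslack : ∀ y, B - ∑ i, (y + x₀) i • A i = Zmat n r - ∑ i, y i • A i := fun y => by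
    simp only [← hx₀, Pi.add_apply, add_smul, Finset.sum_add_distrib]
    abel
  let 𝒜 := Φ₁.comp (LinearMap.ker Φ₂).subtype
  have hset : {s | ∃ x, (1 - 𝒜 x).PosSemidef ∧ s = (γ.comp (LinearMap.ker Φ₂).subtype) x} =
      (fun s => s - γ x₀) '' PrimalVals A B c := by
    ext s
    simp only [PrimalVals, Set.mem_ofPred_eq, Set.mem_image]
    have hblock : ∀ y, block11 r h (Zmat n r - ∑ i, y i • A i) = 1 - Φ₁ y := fun y => by
      rw [hΦ₁, ← (block_Zmat h).1]
      rfl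
    constructor
    · rintro ⟨⟨y, hy⟩, hpsd, rfl⟩
      rw [LinearMap.mem_ker, hΦ₂] at hy
      refine ⟨_, ⟨y + x₀, ?_, rfl⟩, ?_⟩
      · rw [IsFeasible, hslack]
        have h12 : block12 r h (Zmat n r - ∑ i, y i • A i) = 0 := by
          change block12 r h (Zmat n r) - block12 r h (∑ i, y i • A i) = 0
          rw [(block_Zmat h).2.1, hG y hy, sub_zero]
        have h22 : block22 r h (Zmat n r - ∑ i, y i • A i) = 0 := by
          change block22 r h (Zmat n r) - block22 r h (∑ i, y i • A i) = 0
          rw [(block_Zmat h).2.2, hy, sub_zero]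
        refine posSemidef_of_block12_eq_zero h
          ((posSemidef_Zmat h).isSymm.sub (isSymm_sum_smul y hA)) ?_ h12 (by rw [h22]; exact .zero)
        rw [hblock]
        exact hpsd
      · rw [← hγ, map_add, add_sub_cancel_right]
        rfl
    · rintro ⟨_, ⟨x, hx, rfl⟩, rfl⟩
      have hxs := slack_block_eq_zero h hZ hx
      have hx' : B - ∑ i, x i • A i = Zmat n r - ∑ i, (x - x₀) i • A i := by
        rw [← hslack, sub_add_cancel]
      rw [IsFeasible, hx'] at hx
      rw [hx'] at hxs
      have hker : Φ₂ (x - x₀) = 0 := by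
        have h1 : block22 r h (Zmat n r) - block22 r h (∑ i, (x - x₀) i • A i) = 0 := hxs.2
        rw [hΦ₂]
        rwa [(block_Zmat h).2.2, zero_sub, neg_eq_zero] at h1
      refine ⟨⟨x - x₀, hker⟩, ?_, ?_⟩
      · change (1 - Φ₁ (x - x₀)).PosSemidef
        rw [← hblock]
        exact hx.submatrix _
      · change _ = γ (x - x₀)
        rw [map_sub, hγ x]
  have hlub : IsLUB {s | ∃ x, (1 - 𝒜 x).PosSemidef ∧
      s = (γ.comp (LinearMap.ker Φ₂).subtype) x} (v - γ x₀) := by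
    rw [hset]
    exact (OrderIso.subRight (γ x₀)).isLUB_image'.2 hv
  obtain ⟨Y₁, hY₁, hY₁A, hY₁tr⟩ := exists_dual_attaining_of_slater 𝒜
    (fun x => by
      change (Φ₁ x).IsSymm
      rw [hΦ₁]
      exact isSymm_block11 h (isSymm_sum_smul _ hA)) _ _ hlub
  let F : (Fin m → ℝ) →ₗ[ℝ] ℝ := γ -
    ((traceLinearMap (Fin r) ℝ ℝ).comp (LinearMap.mulRight ℝ Y₁)).comp Φ₁
  have hF : ∀ x, F x = γ x - (Φ₁ x * Y₁).trace := fun x => rfl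
  have hFmem : F ∈ LinearMap.range Φ₂.dualMap := by
    rw [LinearMap.range_dualMap_eq_dualAnnihilator_ker, Submodule.mem_dualAnnihilator]
    intro x hx
    rw [hF, sub_eq_zero]
    exact (hY₁A ⟨x, hx⟩).symm
  obtain ⟨g, hg⟩ := hFmem
  obtain ⟨W, hWs, hW⟩ := exists_isSymm_forall_trace_mul_eq g
  obtain ⟨t, -, ht⟩ := exists_pos_quadForm_add_smul_nonneg W U (fun x hx => by
    simpa using hU.dotProduct_mulVec_pos hx)
  have hYA : ∀ i, ip (A i) (ofBlocks r h Y₁ 0 0 (W + t • U)) = c i := by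
    intro i
    have h1 : g (Φ₂ (Pi.single i 1)) = F (Pi.single i 1) := LinearMap.congr_fun hg _
    have h2 : Φ₁ (Pi.single i 1) = block11 r h (A i) := by simp [Φ₁]
    have h3 : Φ₂ (Pi.single i 1) = block22 r h (A i) := by simp [Φ₂]
    have h4 : γ (Pi.single i 1) = c i := by simp [γ]
    rw [hF, h2, h3, h4, hW _ (isSymm_block22 h (hA i))] at h1
    rw [ip_ofBlocks, Matrix.mul_zero, Matrix.mul_zero, mul_add, mul_smul_comm, trace_add,
      trace_smul, hAU, trace_zero, trace_zero, smul_zero, h1]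
    ring
  refine hno ⟨_, posSemidef_ofBlocks_diagonal h hY₁
    (.of_isSymm (hWs.add (hU.posSemidef.isSymm.smul t)) ht), hYA, ?_⟩
  have hBeq : B = Zmat n r + ∑ i, x₀ i • A i := by rw [← hx₀, sub_add_cancel]
  rw [hBeq, ip_add, ip_sum_smul]
  simp only [hYA]
  rw [ip_ofBlocks, (block_Zmat h).1, (block_Zmat h).2.2, one_mul, hY₁tr, hγ]
  simp [mul_comm]

/-- A subspace of `ℝ^m` has a basis that extends to a basis of `ℝ^m` by vectors on which any map
with this kernel is linearly independent. -/
theorem exists_isUnit_adapted_to_ker {m : ℕ} {E : Type*} [AddCommGroup E] [Module ℝ E]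
    (f : (Fin m → ℝ) →ₗ[ℝ] E) :
    ∃ (M : Matrix (Fin m) (Fin m) ℝ) (k : ℕ) (_ : k ≤ m), IsUnit M ∧
      (∀ i : Fin m, (i : ℕ) < k → f (M i) = 0) ∧
      LinearIndependent ℝ (fun i : Fin (m - k) => f (M ⟨k + i.1, by omega⟩)) := by
  obtain ⟨Q, hQ⟩ := (LinearMap.ker f).exists_isCompl
  have hdim := Submodule.finrank_add_eq_of_isCompl hQ
  rw [Module.finrank_fin_fun] at hdim
  obtain ⟨k, hkf⟩ : ∃ k, Module.finrank ℝ (LinearMap.ker f) = k := ⟨_, rfl⟩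
  have hk : k ≤ m := by omega
  have hQk : Module.finrank ℝ Q = m - k := by omega
  have b := Module.finBasisOfFinrankEq ℝ (LinearMap.ker f) hkf
  have d := Module.finBasisOfFinrankEq ℝ Q hQk
  have hb : LinearIndependent ℝ fun i => (b i : Fin m → ℝ) :=
    b.linearIndependent.map' (LinearMap.ker f).subtype (Submodule.ker_subtype _)
  have hd : LinearIndependent ℝ fun i => (d i : Fin m → ℝ) :=
    d.linearIndependent.map' Q.subtype (Submodule.ker_subtype _)
  have hbs : Submodule.span ℝ (Set.range fun i => (b i : Fin m → ℝ)) ≤ LinearMap.ker f :=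
    Submodule.span_le.2 (by rintro _ ⟨i, rfl⟩; exact (b i).2)
  have hds : Submodule.span ℝ (Set.range fun i => (d i : Fin m → ℝ)) ≤ Q :=
    Submodule.span_le.2 (by rintro _ ⟨i, rfl⟩; exact (d i).2)
  obtain ⟨w, hwdef⟩ : ∃ w : Fin m → Fin m → ℝ, w =
    Sum.elim (fun i => (b i : Fin m → ℝ)) (fun i => (d i : Fin m → ℝ)) ∘ (splitEquiv k hk).symm :=
    ⟨_, rfl⟩
  have hw : LinearIndependent ℝ w := by
    rw [hwdef]
    exact (hb.sum_type hd (hQ.disjoint.mono hbs hds)).comp _ (splitEquiv k hk).symm.injective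
  have hinr : ∀ i : Fin (m - k), w ⟨k + i.1, by omega⟩ = d i := fun i => by
    have : (⟨k + i.1, by omega⟩ : Fin m) = splitEquiv k hk (Sum.inr i) :=
      Fin.ext (splitEquiv_inr_val hk i).symm
    simp [hwdef, this]
  have hinl : ∀ i : Fin k, w ⟨i.1, by omega⟩ = b i := fun i => by
    have : (⟨i.1, by omega⟩ : Fin m) = splitEquiv k hk (Sum.inl i) :=
      Fin.ext (splitEquiv_inl_val hk i).symm
    simp [hwdef, this]
  have hwu : IsUnit (Matrix.of w) := by
    rw [← linearIndependent_rows_iff_isUnit]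
    exact hw
  refine ⟨Matrix.of w, k, hk, hwu, fun i hi => ?_, ?_⟩
  · have hwi : w i = b ⟨i.1, hi⟩ := hinl ⟨i.1, hi⟩
    change f (w i) = 0
    rw [hwi]
    exact (b ⟨i.1, hi⟩).2
  · have := hd.map (f := f) (hQ.disjoint.symm.mono_left hds)
    have heq : (fun i : Fin (m - k) => f (w ⟨k + i.1, by omega⟩)) = f ∘ fun i => (d i : Fin m → ℝ) :=
      funext fun i => congrArg f (hinr i)
    change LinearIndependent ℝ (fun i : Fin (m - k) => f (w ⟨k + i.1, by omega⟩))
    rwa [heq]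

theorem Tmat_eq_ofBlocks {n r : ℕ} (h : r ≤ n) (N : Matrix (Fin (n - r)) (Fin (n - r)) ℝ) :
    Tmat r h N = ofBlocks r h 1 0 0 N := by
  have : (Tmat r h N).submatrix (splitEquiv r h) (splitEquiv r h) = fromBlocks 1 0 0 N := by
    ext i j
    rcases i with i | i <;> rcases j with j | j <;>
      simp [Tmat, splitEquiv_inl_val, splitEquiv_inr_val, one_apply]
  rw [ofBlocks, ← this]
  simp

theorem Tmat_one {n r : ℕ} (h : r ≤ n) : Tmat r h 1 = 1 := by
  rw [Tmat_eq_ofBlocks, ofBlocks, fromBlocks_one, submatrix_one_equiv]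

theorem isUnit_of_isUnit_Tmat {n r : ℕ} (h : r ≤ n)
    {N : Matrix (Fin (n - r)) (Fin (n - r)) ℝ} (hT : IsUnit (Tmat r h N)) : IsUnit N := by
  rw [isUnit_iff_isUnit_det] at hT ⊢
  rwa [Tmat_eq_ofBlocks, ofBlocks, det_submatrix_equiv_self, det_fromBlocks_zero₂₁, det_one,
    one_mul] at hT

theorem block_congr_Tmat {n r : ℕ} (h : r ≤ n) (N : Matrix (Fin (n - r)) (Fin (n - r)) ℝ)
    (V : Matrix (Fin n) (Fin n) ℝ) :
    block12 r h ((Tmat r h N)ᵀ * V * Tmat r h N) = block12 r h V * N ∧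
    block22 r h ((Tmat r h N)ᵀ * V * Tmat r h N) = Nᵀ * block22 r h V * N := by
  have hsub := submatrix_splitEquiv h ((Tmat r h N)ᵀ * V * Tmat r h N)
  rw [← submatrix_mul_equiv _ _ _ (splitEquiv r h), ← submatrix_mul_equiv _ _ _ (splitEquiv r h),
    ← transpose_submatrix, Tmat_eq_ofBlocks, submatrix_ofBlocks, submatrix_splitEquiv,
    fromBlocks_transpose, fromBlocks_multiply, fromBlocks_multiply, fromBlocks_inj] at hsub
  rw [Tmat_eq_ofBlocks]
  constructor
  · rw [← hsub.2.1]
    simp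
  · rw [← hsub.2.2.2]
    simp

theorem exists_goodNormalForm_of_goodConds {n m r : ℕ} (h : r ≤ n)
    {A : Fin m → Matrix (Fin n) (Fin n) ℝ} {B : Matrix (Fin n) (Fin n) ℝ}
    (hA : ∀ i, (A i).IsSymm) (hZ : MaxRankSlack A B r)
    {U : Matrix (Fin (n - r)) (Fin (n - r)) ℝ} (hU : U.PosDef)
    (hAU : ∀ i, (block22 r h (A i) * U).trace = 0) (hG : GoodCond2 A r h) :
    ∃ (A' : Fin m → Matrix (Fin n) (Fin n) ℝ) (B' : Matrix (Fin n) (Fin n) ℝ),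
      ElemReform r h A B A' B' ∧ GoodNormalForm A' B' r h := by
  obtain ⟨⟨x₀, hx₀⟩, hmax⟩ := hZ
  obtain ⟨M, k, hk, hM, hker, hind⟩ := exists_isUnit_adapted_to_ker
    (Fintype.linearCombination ℝ fun i => block22 r h (A i))
  simp only [Fintype.linearCombination_apply, ← (block_sum_smul h _ A).2.2] at hker hind
  refine ⟨fun i => ∑ j, M i j • A j, Zmat n r,
    ⟨M, -x₀, 1, hM, ?_, fun i => ?_, ?_⟩, rfl, ⟨⟨0, by simp⟩, fun x hx => ?_⟩, k, hk,
    fun i hi a b hab => ?_, hind, U, hU, fun i _ => ?_⟩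
  · rw [Tmat_one]
    exact isUnit_one
  · rw [Tmat_one, transpose_one, Matrix.one_mul, Matrix.mul_one]
  · rw [Tmat_one, transpose_one, Matrix.one_mul, Matrix.mul_one, ← hx₀]
    simp [sub_eq_add_neg]
  · have hslack : Zmat n r - ∑ i, x i • ∑ j, M i j • A j =
        B - ∑ j, (x ᵥ* M + x₀) j • A j := by
      have : ∑ i, x i • ∑ j, M i j • A j = ∑ j, (x ᵥ* M) j • A j := by
        simp only [Finset.smul_sum, vecMul, dotProduct, Finset.sum_smul, smul_smul]
        exact Finset.sum_comm
      rw [this, ← hx₀]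
      simp only [Pi.add_apply, add_smul, Finset.sum_add_distrib]
      abel
    rw [IsFeasible, hslack] at hx
    rw [hslack]
    exact hmax _ hx
  · set V := ∑ j, M i j • A j with hV
    have hVs : V.IsSymm := isSymm_sum_smul (M i) hA
    have h22 : block22 r h V = 0 := hker i hi
    have h12 : block12 r h V = 0 := hG (M i) h22
    have hcol : ∀ a b : Fin n, r ≤ (b : ℕ) → V a b = 0 := by
      intro a b hb
      have hb' : b = ⟨r + (⟨b - r, by omega⟩ : Fin (n - r)).1, by grind⟩ := Fin.ext (by grind)
      rcases lt_or_ge (a : ℕ) r with ha | ha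
      · rw [hb']
        exact congrFun (congrFun h12 ⟨a, ha⟩) ⟨b - r, by omega⟩
      · have ha' : a = ⟨r + (⟨a - r, by omega⟩ : Fin (n - r)).1, by grind⟩ := Fin.ext (by grind)
        rw [hb', ha']
        exact congrFun (congrFun h22 ⟨a - r, by omega⟩) ⟨b - r, by omega⟩
    rcases hab with ha | hb
    · exact (hVs.apply b a).trans (hcol b a ha)
    · exact hcol a b hb
  · rw [(block_sum_smul h _ A).2.2, ip, Finset.sum_mul, trace_sum]
    refine Finset.sum_eq_zero fun j _ => ?_
    rw [smul_mul_assoc, trace_smul, hAU, smul_zero]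

theorem goodConds_of_goodNormalForm {n m r : ℕ} (h : r ≤ n)
    {A A' : Fin m → Matrix (Fin n) (Fin n) ℝ} {B B' : Matrix (Fin n) (Fin n) ℝ}
    (href : ElemReform r h A B A' B') (hnf : GoodNormalForm A' B' r h) :
    (∃ U : Matrix (Fin (n - r)) (Fin (n - r)) ℝ, U.PosDef ∧
      ∀ i, (block22 r h (A i) * U).trace = 0) ∧ GoodCond2 A r h := by
  obtain ⟨M, μ, N, hM, hT, hA', -⟩ := href
  obtain ⟨-, -, k, hk, hzero, hind, U, hU, hAU⟩ := hnf
  have hN := isUnit_of_isUnit_Tmat h hT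
  have hdet := (isUnit_iff_isUnit_det _).1 hM
  have hcomb : ∀ lam : Fin m → ℝ, (Tmat r h N)ᵀ * (∑ j, lam j • A j) * Tmat r h N =
      ∑ i, (lam ᵥ* M⁻¹) i • A' i := by
    intro lam
    have h1 : ∑ j, lam j • A j = ∑ i, (lam ᵥ* M⁻¹) i • ∑ j, M i j • A j := by
      have h2 : lam = (lam ᵥ* M⁻¹) ᵥ* M := by
        rw [vecMul_vecMul, nonsing_inv_mul _ hdet, vecMul_one]
      conv_lhs => rw [h2]
      generalize lam ᵥ* M⁻¹ = x
      simp only [Finset.smul_sum, vecMul, dotProduct, Finset.sum_smul, smul_smul]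
      exact Finset.sum_comm
    rw [h1]
    simp only [hA', Finset.mul_sum, Finset.sum_mul, mul_smul_comm, smul_mul_assoc]
  have hA'U : ∀ i, (block22 r h (A' i) * U).trace = 0 := by
    intro i
    rcases lt_or_ge (i : ℕ) k with hi | hi
    · have : block22 r h (A' i) = 0 := by
        ext a b
        exact hzero i hi _ _ (Or.inl (Nat.le_add_right _ _))
      rw [this, Matrix.zero_mul, trace_zero]
    · exact hAU i hi
  refine ⟨⟨N * U * Nᴴ, ?_, fun i => ?_⟩, fun lam hlam => ?_⟩
  · exact (IsUnit.posDef_star_right_conjugate_iff hN).2 hU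
  · have h1 := hcomb (Pi.single i 1)
    have h2 : ∑ j, (Pi.single i 1 : Fin m → ℝ) j • A j = A i := by
      simp [Pi.single_apply, ite_smul]
    rw [h2] at h1
    have h3 : (block22 r h (A i) * (N * U * Nᴴ)).trace =
        (block22 r h ((Tmat r h N)ᵀ * A i * Tmat r h N) * U).trace := by
      rw [(block_congr_Tmat h N _).2, conjTranspose_eq_transpose_of_trivial, ← Matrix.mul_assoc,
        trace_mul_comm]
      simp only [Matrix.mul_assoc]
    rw [h3, h1, (block_sum_smul h _ A').2.2, Finset.sum_mul, trace_sum]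
    refine Finset.sum_eq_zero fun j _ => ?_
    rw [smul_mul_assoc, trace_smul, hA'U, smul_zero]
  · set x := lam ᵥ* M⁻¹ with hx
    have h22 : ∑ i, x i • block22 r h (A' i) = 0 := by
      rw [← (block_sum_smul h x A').2.2, ← hcomb, (block_congr_Tmat h N _).2, hlam]
      simp
    have hx0 : ∀ i : Fin m, k ≤ (i : ℕ) → x i = 0 := by
      rw [← (splitEquiv k hk).sum_comp, Fintype.sum_sum_type] at h22
      rw [Finset.sum_eq_zero (s := Finset.univ) (f := fun i : Fin k => _) fun i _ => ?_,
        zero_add] at h22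
      · rw [Fintype.linearIndependent_iff] at hind
        have hinr : ∀ i : Fin (m - k), splitEquiv k hk (Sum.inr i) = ⟨k + i.1, by omega⟩ :=
          fun i => Fin.ext (splitEquiv_inr_val hk i)
        simp only [hinr] at h22
        have h3 := hind _ h22
        intro i hi
        have h4 := h3 ⟨i - k, by omega⟩
        have h5 : (⟨k + (i - k), by omega⟩ : Fin m) = i := Fin.ext (by simp; omega)
        simpa only [h5] using h4
      · have : block22 r h (A' (splitEquiv k hk (Sum.inl i))) = 0 := by
          ext a b
          exact hzero _ (by rw [splitEquiv_inl_val]; exact i.2) _ _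
            (Or.inl (Nat.le_add_right _ _))
        rw [this, smul_zero]
    have h12 : block12 r h (∑ j, lam j • A j) * N = 0 := by
      rw [← (block_congr_Tmat h N _).1, hcomb, (block_sum_smul h _ A').2.1]
      refine Finset.sum_eq_zero fun i _ => ?_
      rcases lt_or_ge (i : ℕ) k with hi | hi
      · have : block12 r h (A' i) = 0 := by
          ext a b
          exact hzero i hi _ _ (Or.inr (Nat.le_add_right _ _))
        rw [this, smul_zero]
      · rw [← hx, hx0 i hi, zero_smul]
    have := congrArg (· * N⁻¹) h12
    simpa [Matrix.mul_assoc, mul_nonsing_inv _ ((isUnit_iff_isUnit_det _).1 hN)] using this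

/-- Under the maximum rank slack assumption, the feasible system
is well behaved iff it has an elementary reformulation in good normal form. -/
theorem stmt3 {n m : ℕ} (hn : 0 < n) (hm : 0 < m)
    (A : Fin m → Matrix (Fin n) (Fin n) ℝ) (B : Matrix (Fin n) (Fin n) ℝ)
    (hA : ∀ i, (A i).IsSymm) (hB : B.IsSymm)
    (hfeas : ∃ x : Fin m → ℝ, IsFeasible A B x)
    (r : ℕ) (hr : r ≤ n) (hZ : MaxRankSlack A B r) :
    ¬ BadlyBehaved A B ↔
      ∃ (A' : Fin m → Matrix (Fin n) (Fin n) ℝ) (B' : Matrix (Fin n) (Fin n) ℝ),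
        ElemReform r hr A B A' B' ∧ GoodNormalForm A' B' r hr := by
  constructor
  · intro hgood
    obtain ⟨⟨U, hU, hAU⟩, hG⟩ := goodConds_of_not_badlyBehaved hr hA hB hZ hgood
    exact exists_goodNormalForm_of_goodConds hr hA hZ hU hAU hG
  · rintro ⟨A', B', href, hnf⟩
    obtain ⟨⟨U, hU, hAU⟩, hG⟩ := goodConds_of_goodNormalForm hr href hnf
    exact not_badlyBehaved_of_goodConds hr hA hZ hU hAU hG
end

section
/- Suppose B = diag(I_r, 0) is a maximum rank slack of the semidefinite system (P_SD) (so every slack has rank at most r), the last n−r columns of A_i are zero for i = 1,…,k, and the last n−r columns of A_{k+1},…,A_m, viewed as n×(n−r) matrices, are linearly independent. Then every feasible x satisfies x_{k+1} = x_{k+2} = … = x_m = 0. -/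
open Matrix

theorem zmat_eq_diagonal (n r : ℕ) :
    Zmat n r = Matrix.diagonal (fun i : Fin n => if (i : ℕ) < r then (1 : ℝ) else 0) := by
  ext i j
  by_cases h : i = j <;> simp [Zmat, h]

theorem posSemidef_zmat (n r : ℕ) : (Zmat n r).PosSemidef := by
  rw [zmat_eq_diagonal, Matrix.posSemidef_diagonal_iff]
  intro i
  split_ifs <;> norm_num

theorem rank_zmat {n r : ℕ} (hr : r ≤ n) : (Zmat n r).rank = r := by
  rw [zmat_eq_diagonal, Matrix.rank_diagonal]
  have e : {i : Fin n // (if (i : ℕ) < r then (1 : ℝ) else 0) ≠ 0} ≃ Fin r :=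
    { toFun := fun i => ⟨i.1, by have := i.2; simpa using this⟩
      invFun := fun j => ⟨⟨j.1, by omega⟩, by simp⟩
      left_inv := fun i => by ext; rfl
      right_inv := fun j => by ext; rfl }
  simpa using Fintype.card_congr e

/-- If adding a positive semidefinite matrix `S` to a positive semidefinite `Z` does not increase
the rank, then the kernel of `Z` is contained in the kernel of `S`. -/
theorem mulVec_eq_zero_of_rank_add_le {ι : Type*} [Fintype ι] [DecidableEq ι]
    {Z S : Matrix ι ι ℝ}
    (hZ : Z.PosSemidef) (hS : S.PosSemidef) (hrank : (Z + S).rank ≤ Z.rank)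
    {v : ι → ℝ} (hv : Z *ᵥ v = 0) : S *ᵥ v = 0 := by
  have hle : LinearMap.ker (Z + S).mulVecLin ≤ LinearMap.ker Z.mulVecLin := by
    intro w hw
    simp only [LinearMap.mem_ker, Matrix.mulVecLin_apply] at hw ⊢
    rw [← hZ.dotProduct_mulVec_zero_iff]
    have hsum : star w ⬝ᵥ (Z *ᵥ w) + star w ⬝ᵥ (S *ᵥ w) = 0 := by
      rw [← dotProduct_add, ← Matrix.add_mulVec, hw, dotProduct_zero]
    have := hZ.dotProduct_mulVec_nonneg w
    have := hS.dotProduct_mulVec_nonneg w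
    linarith
  have heq : LinearMap.ker (Z + S).mulVecLin = LinearMap.ker Z.mulVecLin := by
    apply Submodule.eq_of_le_of_finrank_le hle
    have h₁ := LinearMap.finrank_range_add_finrank_ker (Z + S).mulVecLin
    have h₂ := LinearMap.finrank_range_add_finrank_ker Z.mulVecLin
    unfold Matrix.rank at hrank
    omega
  have hmem : v ∈ LinearMap.ker (Z + S).mulVecLin := by
    rw [heq]; simpa using hv
  simpa [Matrix.add_mulVec, hv] using hmem

/-- If `B = diag(I_r, 0)` is a maximum rank slack, the last `n - r`
columns of `A₁, …, A_k` vanish, and the last `n - r` columns of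
`A_{k+1}, …, A_m` are linearly independent, then every feasible `x` has
`x_{k+1} = ⋯ = x_m = 0`. -/
theorem stmt5 {n m : ℕ} (hn : 0 < n) (hm : 0 < m)
    (A : Fin m → Matrix (Fin n) (Fin n) ℝ) (B : Matrix (Fin n) (Fin n) ℝ)
    (hA : ∀ i, (A i).IsSymm) (hB : B.IsSymm)
    (r : ℕ) (hr : r ≤ n)
    (hBZ : B = Zmat n r) (hZ : MaxRankSlack A B r)
    (k : ℕ) (hk : k < m)
    (hzero : ∀ i : Fin m, (i : ℕ) < k → ∀ a b : Fin n, r ≤ (b : ℕ) → A i a b = 0)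
    (hind : LinearIndependent ℝ
      (fun i : Fin (m - k) => lastCols r hr (A ⟨k + i.1, by omega⟩)))
    (x : Fin m → ℝ) (hx : IsFeasible A B x) :
    ∀ i : Fin m, k ≤ (i : ℕ) → x i = 0 := by
  subst hBZ
  have hS : (Zmat n r - ∑ i, x i • A i).PosSemidef := hx
  have hmid : Zmat n r - ∑ i, ((1 / 2 : ℝ) • x) i • A i =
      (1 / 2 : ℝ) • (Zmat n r + (Zmat n r - ∑ i, x i • A i)) := by
    simp only [Pi.smul_apply, smul_assoc, ← Finset.smul_sum]
    module
  have hrank : (Zmat n r + (Zmat n r - ∑ i, x i • A i)).rank ≤ (Zmat n r).rank := by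
    have hfeas : IsFeasible A (Zmat n r) ((1 / 2 : ℝ) • x) := by
      rw [IsFeasible, hmid]
      exact ((posSemidef_zmat n r).add hS).smul (by norm_num)
    have h := hZ.2 _ hfeas
    rw [hmid, Matrix.rank_smul_of_mem_nonZeroDivisors _
      (mem_nonZeroDivisors_of_ne_zero (by norm_num))] at h
    rwa [rank_zmat hr]
  have hcol : ∀ a b : Fin n, r ≤ (b : ℕ) → ∑ i, x i * A i a b = 0 := by
    intro a b hb
    have hZb : ∀ c, Zmat n r c b = 0 := fun c => by
      simp only [Zmat, Matrix.of_apply, ite_eq_right_iff]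
      rintro ⟨rfl, h⟩
      omega
    have hker : Zmat n r *ᵥ Pi.single b 1 = 0 := by
      ext c; simp [hZb]
    have h := congrFun
      (mulVec_eq_zero_of_rank_add_le (posSemidef_zmat n r) hS hrank hker) a
    simpa [hZb, Matrix.sum_apply] using h
  have hsum : ∑ i : Fin (m - k), x ⟨k + i.1, by omega⟩ •
      lastCols r hr (A ⟨k + i.1, by omega⟩) = 0 := by
    ext a j
    have h := hcol a ⟨r + j.1, by omega⟩ (by simp)
    have e : k + (m - k) = m := by omega
    rw [← (finCongr e).sum_comp, Fin.sum_univ_add] at h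
    rw [Finset.sum_eq_zero (fun i _ => by
      rw [hzero _ (by simp) _ _ (by simp), mul_zero]), zero_add] at h
    simp only [Matrix.sum_apply, Matrix.smul_apply, smul_eq_mul, lastCols, Matrix.of_apply,
      Matrix.zero_apply]
    exact h
  intro i hi
  have h := Fintype.linearIndependent_iff.mp hind _ hsum ⟨i.1 - k, by omega⟩
  simpa [Nat.add_sub_cancel' hi] using h
end

section
/- Let B_1,…,B_m be real symmetric k×k matrices. If there is no positive definite symmetric k×k matrix U with B_i • U = 0 for all i = 1,…,m, then there exists a nonzero positive semidefinite symmetric matrix W lying in the linear span of B_1,…,B_m. -/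
open Matrix

/-- A linear functional on matrices is the trace pairing with the transposed matrix of its values
on the standard basis. -/
theorem linearMap_eq_trace_mul {k : ℕ} (f : Matrix (Fin k) (Fin k) ℝ →ₗ[ℝ] ℝ) :
    ∃ F : Matrix (Fin k) (Fin k) ℝ, ∀ X, f X = trace (X * F) := by
  refine ⟨of fun i j => f (single j i 1), fun X => ?_⟩
  conv_lhs => rw [matrix_eq_sum_single X]
  simp only [map_sum, trace, diag_apply, mul_apply, of_apply]
  refine Finset.sum_congr rfl fun i _ => Finset.sum_congr rfl fun j _ => ?_
  rw [← mul_one (X i j), ← smul_eq_mul, ← smul_single, map_smul, smul_eq_mul, smul_eq_mul, mul_one]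

/-- Positive semidefinite matrices of trace one form a convex set. -/
theorem convex_posSemidef_trace_eq_one (k : ℕ) :
    Convex ℝ {M : Matrix (Fin k) (Fin k) ℝ | M.PosSemidef ∧ M.trace = 1} := by
  rintro M ⟨hM, hMt⟩ N ⟨hN, hNt⟩ a b ha hb hab
  refine ⟨(hM.smul ha).add (hN.smul hb), ?_⟩
  rw [trace_add, trace_smul, trace_smul, hMt, hNt, smul_eq_mul, smul_eq_mul, mul_one, mul_one, hab]

/-- The entries of a positive semidefinite matrix are bounded by its trace. -/
theorem Matrix.PosSemidef.abs_apply_le_trace {k : ℕ} {M : Matrix (Fin k) (Fin k) ℝ}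
    (hM : M.PosSemidef) (i j : Fin k) : |M i j| ≤ M.trace := by
  have hdiag : ∀ l, M l l ≤ M.trace := fun l =>
    Finset.single_le_sum (f := fun l => M l l) (fun l _ => hM.diag_nonneg) (Finset.mem_univ l)
  have hji : M j i = M i j := by simpa using hM.1.apply i j
  have hadd := hM.dotProduct_mulVec_nonneg (Pi.single i 1 + Pi.single j 1)
  have hsub := hM.dotProduct_mulVec_nonneg (Pi.single i 1 - Pi.single j 1)
  simp only [star_trivial, mulVec_add, mulVec_sub, add_dotProduct, sub_dotProduct, dotProduct_add,
    dotProduct_sub, mulVec_single_one, single_one_dotProduct, col_apply, hji] at hadd hsub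
  have hi := hdiag i
  have hj := hdiag j
  rw [abs_le]
  constructor <;> linarith

/-- Positive semidefinite matrices of trace one form a compact set. -/
theorem isCompact_posSemidef_trace_eq_one (k : ℕ) :
    IsCompact {M : Matrix (Fin k) (Fin k) ℝ | M.PosSemidef ∧ M.trace = 1} := by
  have hbox : IsCompact (Set.univ.pi fun _ => Set.univ.pi fun _ => Set.Icc (-1) 1 :
      Set (Matrix (Fin k) (Fin k) ℝ)) :=
    isCompact_univ_pi fun _ => isCompact_univ_pi fun _ => isCompact_Icc
  refine hbox.of_isClosed_subset ?_ ?_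
  · simp only [posSemidef_iff_dotProduct_mulVec, IsHermitian, Set.ofPred_and, Set.ofPred_forall]
    refine (IsClosed.inter ?_ (isClosed_iInter fun x => ?_)).inter ?_
    · exact isClosed_eq (by fun_prop) (by fun_prop)
    · exact isClosed_le (by fun_prop) (by fun_prop)
    · exact isClosed_eq (by fun_prop) (by fun_prop)
  · rintro M ⟨hM, hMt⟩ i - j -
    exact abs_le.1 (hMt ▸ hM.abs_apply_le_trace i j)

/-- A matrix `F` with `xᵀFx > 0` for all `x ≠ 0` has positive definite symmetric part. -/
theorem posDef_add_transpose {k : ℕ} {F : Matrix (Fin k) (Fin k) ℝ}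
    (hF : ∀ x ≠ 0, 0 < x ⬝ᵥ F *ᵥ x) : (F + Fᵀ).PosDef := by
  refine .of_dotProduct_mulVec_pos ?_ fun x hx => ?_
  · rw [IsHermitian, conjTranspose_eq_transpose_of_trivial, transpose_add, transpose_transpose,
      add_comm]
  · have hT : x ⬝ᵥ Fᵀ *ᵥ x = x ⬝ᵥ F *ᵥ x := by
      rw [mulVec_transpose, dotProduct_comm, dotProduct_mulVec]
    rw [star_trivial, add_mulVec, dotProduct_add, hT]
    exact add_pos (hF x hx) (hF x hx)

/-- If no positive definite `U` satisfies `Bᵢ • U = 0` for all `i`,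
then some nonzero positive semidefinite `W` lies in the span of the `Bᵢ`. -/
theorem stmt8 {k m : ℕ} (Bm : Fin m → Matrix (Fin k) (Fin k) ℝ)
    (hsymm : ∀ i, (Bm i).IsSymm)
    (h : ¬ ∃ U : Matrix (Fin k) (Fin k) ℝ, U.PosDef ∧ ∀ i, ip (Bm i) U = 0) :
    ∃ W : Matrix (Fin k) (Fin k) ℝ, W ≠ 0 ∧ W.PosSemidef ∧
      W ∈ Submodule.span ℝ (Set.range Bm) := by
  by_contra! hW
  let S := Submodule.span ℝ (Set.range Bm)
  have : LocallyConvexSpace ℝ (Matrix (Fin k) (Fin k) ℝ) :=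
    inferInstanceAs (LocallyConvexSpace ℝ (Fin k → Fin k → ℝ))
  have hdisj : Disjoint {M : Matrix (Fin k) (Fin k) ℝ | M.PosSemidef ∧ M.trace = 1} S := by
    refine Set.disjoint_left.2 fun M hM hMS => hW M ?_ hM.1 hMS
    rintro rfl
    simpa using hM.2
  obtain ⟨f, u, v, hfK, huv, hfS⟩ := geometric_hahn_banach_compact_closed
    (convex_posSemidef_trace_eq_one k) (isCompact_posSemidef_trace_eq_one k) S.convex
    S.closed_of_finiteDimensional hdisj
  have hv : v < 0 := by simpa using hfS 0 S.zero_mem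
  have hfB : ∀ M ∈ S, f M = 0 := by
    intro M hM
    by_contra hne
    have := hfS ((v / f M) • M) (S.smul_mem _ hM)
    rw [map_smul, smul_eq_mul, div_mul_cancel₀ _ hne] at this
    exact this.false
  obtain ⟨F, hF⟩ := linearMap_eq_trace_mul
    (-f : StrongDual ℝ (Matrix (Fin k) (Fin k) ℝ)).toLinearMap
  have hF' : ∀ X, trace (X * F) = -f X := fun X => (hF X).symm
  refine h ⟨F + Fᵀ, posDef_add_transpose fun x hx => ?_, fun i => ?_⟩
  · have hx' : 0 < x ⬝ᵥ x := by simpa using dotProduct_star_self_pos_iff.2 hx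
    have hlt := hfK ((x ⬝ᵥ x)⁻¹ • vecMulVec x x)
      ⟨.smul (by simpa using posSemidef_vecMulVec_self_star x) (inv_pos.2 hx').le, by
        rw [trace_smul, trace_vecMulVec, smul_eq_mul, inv_mul_cancel₀ hx'.ne']⟩
    have hval : x ⬝ᵥ F *ᵥ x = -f (vecMulVec x x) := by
      rw [← hF', vecMulVec_mul, trace_vecMulVec, dotProduct_comm x (x ᵥ* F), dotProduct_mulVec]
    rw [map_smul, smul_eq_mul] at hlt
    rw [hval, neg_pos]
    exact neg_of_mul_neg_right (hlt.trans (huv.trans hv)) (inv_pos.2 hx').le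
  · have hB : trace (Bm i * F) = 0 := by
      rw [hF', hfB _ (Submodule.subset_span ⟨i, rfl⟩), neg_zero]
    have hBT : trace (Bm i * Fᵀ) = trace (Bm i * F) := by
      rw [← trace_transpose, transpose_mul, transpose_transpose, hsymm i, trace_mul_comm]
    rw [ip, mul_add, trace_add, hBT, hB, add_zero]
end

section
/- Suppose Z = diag(I_r, 0) is a maximum rank slack of the feasible semidefinite system (P_SD) (Z is a slack and every slack has rank at most r). If V = Σ_{i=1}^m λ_i A_i is a linear combination of the A_i with block form V = [[V_11, V_12],[V_12ᵀ, V_22]] (upper-left block r×r) such that V_22 is positive semidefinite and V_22 ≠ 0, then the column space of V_12ᵀ is not contained in the column space of V_22. -/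
open Matrix

theorem exists_mul_eq_of_colSpace_le {p q s : ℕ} {M : Matrix (Fin p) (Fin q) ℝ}
    {N : Matrix (Fin p) (Fin s) ℝ} (h : colSpace M ≤ colSpace N) :
    ∃ D : Matrix (Fin s) (Fin q) ℝ, M = N * D := by
  have hcol : ∀ j, ∃ d : Fin s → ℝ, N *ᵥ d = M.col j := fun j => by
    have hj : M.col j ∈ colSpace N := h ⟨Pi.single j 1, by simp⟩
    simpa [colSpace] using hj
  choose d hd using hcol
  refine ⟨Matrix.of fun i j => d j i, ?_⟩
  ext i j
  exact (congrFun (hd j) i).symm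

/-- A small symmetric perturbation of the identity is positive definite. -/
theorem exists_pos_posDef_one_add_smul {ι : Type*} [Fintype ι] [DecidableEq ι]
    {M : Matrix ι ι ℝ} (hM : M.IsSymm) : ∃ ε : ℝ, 0 < ε ∧ (1 + ε • M).PosDef := by
  set C : ℝ := ∑ i, ∑ j, |M i j|
  have hC : 0 ≤ C := Finset.sum_nonneg fun i _ => Finset.sum_nonneg fun j _ => abs_nonneg _
  have hbound : ∀ x : ι → ℝ, -(C * (x ⬝ᵥ x)) ≤ x ⬝ᵥ (M *ᵥ x) := by
    intro x
    have hsq : ∀ i, x i * x i ≤ x ⬝ᵥ x := fun i =>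
      Finset.single_le_sum (f := fun i => x i * x i) (fun i _ => mul_self_nonneg _)
        (Finset.mem_univ i)
    simp only [C, Finset.sum_mul, ← Finset.sum_neg_distrib,
      dotProduct.eq_1 x (M *ᵥ x), mulVec, dotProduct.eq_1 (M _) x, Finset.mul_sum]
    refine Finset.sum_le_sum fun i _ => Finset.sum_le_sum fun j _ => ?_
    have hij : |x i * x j| ≤ x ⬝ᵥ x := by
      rw [abs_le]
      constructor <;> nlinarith [hsq i, hsq j, sq_nonneg (x i + x j), sq_nonneg (x i - x j)]
    have habs : |M i j * (x i * x j)| ≤ |M i j| * (x ⬝ᵥ x) := by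
      rw [abs_mul]
      exact mul_le_mul_of_nonneg_left hij (abs_nonneg _)
    have := (abs_le.1 habs).1
    linarith
  refine ⟨(C + 1)⁻¹, by positivity, .of_dotProduct_mulVec_pos ?_ fun x hx => ?_⟩
  · rw [isHermitian_iff_isSymm]
    exact isSymm_one.add (hM.smul _)
  · have hx' : 0 < x ⬝ᵥ x := by
      simpa using dotProduct_star_self_pos_iff.2 hx
    have hε : (C + 1)⁻¹ * (C + 1) = 1 := inv_mul_cancel₀ (by positivity)
    have hε0 : 0 < (C + 1)⁻¹ := by positivity
    simp only [star_trivial, add_mulVec, one_mulVec, smul_mulVec, dotProduct_add,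
      dotProduct_smul, smul_eq_mul]
    nlinarith [mul_le_mul_of_nonneg_left (hbound x) hε0.le, mul_pos hε0 hx']

theorem card_lt_rank_fromBlocks_zero {m n : Type*} [Fintype m] [DecidableEq m] [Fintype n]
    [DecidableEq n] {P : Matrix m m ℝ} {N : Matrix n n ℝ} (hP : IsUnit P) (hN : N ≠ 0) :
    Fintype.card m < (fromBlocks P 0 0 N).rank := by
  obtain ⟨i, j, hij⟩ : ∃ i j, N i j ≠ 0 := by
    by_contra! h
    exact hN (ext h)
  let S : Matrix (m ⊕ Unit) (m ⊕ Unit) ℝ := (fromBlocks P 0 0 N).submatrix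
    (Sum.map id fun _ => i) (Sum.map id fun _ => j)
  have hS : S = fromBlocks P 0 0 (of fun _ _ => N i j) := by
    ext (a | a) (b | b) <;> rfl
  have hdet : S.det ≠ 0 := by
    rw [hS, det_fromBlocks_zero₂₁]
    exact mul_ne_zero ((isUnit_iff_isUnit_det P).1 hP).ne_zero (by simpa using hij)
  calc Fintype.card m < Fintype.card (m ⊕ Unit) := by simp
    _ = S.rank := (rank_of_det_ne_zero hdet).symm
    _ ≤ _ := rank_submatrix_le _ _ _

/-- If `N ⪰ 0` is nonzero and the off-diagonal block factors through `N`, then moving from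
`diag(I, 0)` along `[[K, (N D)ᵀ], [N D, N]]` stays positive semidefinite for a short while and
increases the rank. -/
theorem exists_posSemidef_card_lt_rank_fromBlocks {m n : Type*} [Fintype m] [DecidableEq m]
    [Fintype n] [DecidableEq n] {K : Matrix m m ℝ} {N : Matrix n n ℝ} (hK : K.IsSymm)
    (hN : N.PosSemidef) (hN0 : N ≠ 0) (D : Matrix n m ℝ) :
    ∃ ε : ℝ, (fromBlocks 1 0 0 0 + ε • fromBlocks K (N * D)ᵀ (N * D) N).PosSemidef ∧
      Fintype.card m <
        (fromBlocks 1 0 0 0 + ε • fromBlocks K (N * D)ᵀ (N * D) N).rank := by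
  have hNs : Nᵀ = N := isHermitian_iff_isSymm.1 hN.1
  have hM : (K - Dᵀ * N * D).IsSymm := by
    simp [IsSymm, transpose_sub, transpose_mul, hNs, hK.eq, Matrix.mul_assoc]
  obtain ⟨ε, hε, hP⟩ := exists_pos_posDef_one_add_smul hM
  set P := 1 + ε • (K - Dᵀ * N * D) with hPdef
  let L : Matrix (m ⊕ n) (m ⊕ n) ℝ := fromBlocks 1 0 D 1
  have hLdet : IsUnit L.det := by simp [L]
  have hfac : fromBlocks 1 0 0 0 + ε • fromBlocks K (N * D)ᵀ (N * D) N =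
      Lᵀ * fromBlocks P 0 0 (ε • N) * L := by
    simp [L, fromBlocks_transpose, fromBlocks_multiply, fromBlocks_smul, fromBlocks_add, hPdef,
      hNs, transpose_mul, smul_sub, Matrix.mul_assoc]
    abel
  refine ⟨ε, ?_⟩
  rw [hfac]
  constructor
  · have hblock : (fromBlocks P 0 0 (ε • N)).PosSemidef := by
      let := hP.isUnit.invertible
      simpa using (PosDef.fromBlocks₁₁ (0 : Matrix m n ℝ) (ε • N) hP).2
        (by simpa using hN.smul hε.le)
    simpa [conjTranspose_eq_transpose_of_trivial] using hblock.conjTranspose_mul_mul_same L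
  · rw [rank_mul_eq_left_of_isUnit_det _ _ hLdet,
      rank_mul_eq_right_of_isUnit_det _ _ (by rwa [det_transpose])]
    exact card_lt_rank_fromBlocks_zero hP.isUnit (smul_ne_zero hε.ne' hN0)

/-- If `Z = diag(I_r, 0)` is a maximum rank slack and
`V = ∑ λᵢ Aᵢ` has `V₂₂ ⪰ 0` and `V₂₂ ≠ 0`, then `ℛ(V₁₂ᵀ) ⊄ ℛ(V₂₂)`. -/
theorem stmt9 {n m : ℕ} (hn : 0 < n) (hm : 0 < m)
    (A : Fin m → Matrix (Fin n) (Fin n) ℝ) (B : Matrix (Fin n) (Fin n) ℝ)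
    (hA : ∀ i, (A i).IsSymm) (hB : B.IsSymm)
    (hfeas : ∃ x : Fin m → ℝ, IsFeasible A B x)
    (r : ℕ) (hr : r ≤ n) (hZ : MaxRankSlack A B r)
    (lam : Fin m → ℝ)
    (hpsd : (block22 r hr (∑ i, lam i • A i)).PosSemidef)
    (hne : block22 r hr (∑ i, lam i • A i) ≠ 0) :
    ¬ colSpace (block12 r hr (∑ i, lam i • A i))ᵀ ≤
        colSpace (block22 r hr (∑ i, lam i • A i)) := by
  intro hsub
  set V := ∑ i, lam i • A i with hV
  have hVs : V.IsSymm := by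
    simp only [IsSymm, hV, transpose_sum, transpose_smul, (hA _).eq]
  obtain ⟨D, hD⟩ := exists_mul_eq_of_colSpace_le hsub
  let e : Fin r ⊕ Fin (n - r) ≃ Fin n := finSumFinEquiv.trans (finCongr (by omega))
  have hK : (V.submatrix (e ∘ Sum.inl) (e ∘ Sum.inl)).IsSymm := hVs.submatrix _
  obtain ⟨ε, hpos, hrank⟩ := exists_posSemidef_card_lt_rank_fromBlocks hK hpsd hne D
  obtain ⟨⟨x, hx⟩, hmax⟩ := hZ
  have hslack : B - ∑ i, (x - ε • lam) i • A i = Zmat n r + ε • V := by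
    rw [← hx, hV, Finset.smul_sum]
    simp only [Pi.sub_apply, Pi.smul_apply, sub_smul, Finset.sum_sub_distrib, smul_assoc]
    abel
  have hblocks : (Zmat n r + ε • V).submatrix e e = fromBlocks 1 0 0 0 +
      ε • fromBlocks (V.submatrix (e ∘ Sum.inl) (e ∘ Sum.inl)) (block22 r hr V * D)ᵀ
        (block22 r hr V * D) (block22 r hr V) := by
    rw [← hD, transpose_transpose]
    ext (a | a) (b | b)
    · simp [e, Zmat, one_apply, Fin.ext_iff]
    · have : (a : ℕ) ≠ r + b := by omega
      simp [e, Zmat, Fin.ext_iff, this, block12]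
      exact Or.inl rfl
    · have : r + (a : ℕ) ≠ b := by omega
      simp [e, Zmat, Fin.ext_iff, this, block12]
      exact Or.inl (hVs.apply _ _)
    · simp [e, Zmat, block22]
      exact Or.inl rfl
  rw [← hblocks, posSemidef_submatrix_equiv, ← hslack] at hpos
  rw [← hblocks, rank_submatrix, ← hslack, Fintype.card_fin] at hrank
  exact hrank.not_ge (hmax _ hpos)
end
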